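/- arXiv:1206.3637 — 2 statements merged into one kernel-verified Lean document; each statement's English description precedes it below -/
import Mathlib

section
/- Let α ∈ (0,1/2), β ∈ (α,1), t > 0, M > 0, and let c : [0,t] × ℝ → ℝ satisfy |c(s,x)| ≤ M(1+|x|) and |c(s,x) − c(u,y)| ≤ M(|s−u|^β + |x−y|) for all s,u ∈ [0,t], x,y ∈ ℝ. Let g : [0,t] → ℝ be continuous with Λ := ‖g‖_{0;[0,t]} < ∞, and let X : [0,t] → ℝ be measurable with ∫_0^t ( |X_u| (t−u)^{−2α} + ‖X‖_u (t−u)^{−α} ) du < ∞. Then there is a constant C, depending only on α, β, M and t, such that ∫_0^t | ∫_s^t c(u,X_u) dg(u) | (t−s)^{−1−α} ds ≤ C Λ ( 1 + ∫_0^t ( |X_u| (t−u)^{−2α} + ‖X‖_u (t−u)^{−α} ) du ), where the inner integrals are generalized Lebesgue–Stieltjes integrals. -/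
open MeasureTheory Set
open scoped ENNReal

/-- The seminorm `‖g‖_{0;[a,b]}`, valued in `ℝ≥0∞`. -/
noncomputable def zeroNorm (α a b : ℝ) (g : ℝ → ℝ) : ℝ≥0∞ :=
  ⨆ (u : ℝ) (v : ℝ) (_ : a ≤ u) (_ : u < v) (_ : v < b),
    ENNReal.ofReal (|g v - g u| / (v - u) ^ (1 - α)
      + ∫ z in Ioo u v, |g u - g z| / (z - u) ^ (2 - α))

/-- Left-sided fractional derivative `(D^α_{a+} f)(x)`. -/
noncomputable def fracDerivP (α a : ℝ) (f : ℝ → ℝ) (x : ℝ) : ℝ :=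
  (1 / Real.Gamma (1 - α)) *
    (f x / (x - a) ^ α + α * ∫ u in Ioo a x, (f x - f u) / (x - u) ^ (1 + α))

/-- Right-sided fractional derivative `(D^{1-α}_{b-} g_{b-})(x)`. -/
noncomputable def fracDerivM (α b : ℝ) (g : ℝ → ℝ) (x : ℝ) : ℝ :=
  (1 / Real.Gamma α) *
    ((g x - g b) / (b - x) ^ (1 - α) + (1 - α) * ∫ u in Ioo x b, (g x - g u) / (u - x) ^ (2 - α))

/-- Generalized (fractional) Lebesgue–Stieltjes integral `∫_a^b f dg`. -/
noncomputable def glsIntegral (α a b : ℝ) (f g : ℝ → ℝ) : ℝ :=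
  ∫ x in Ioo a b, fracDerivP α a f x * fracDerivM α b g x

/-- `‖X‖_s = ∫_0^s |X_s - X_u| (s-u)^{-1-α} du`, valued in `ℝ≥0∞`. -/
noncomputable def pathNorm (α : ℝ) (X : ℝ → ℝ) (s : ℝ) : ℝ≥0∞ :=
  ∫⁻ u in Ioo (0 : ℝ) s, ENNReal.ofReal (|X s - X u| * (s - u) ^ (-1 - α))

lemma aux_reflect (F : ℝ → ℝ≥0∞) (a x : ℝ) :
    ∫⁻ u in Ioo a x, F (x - u) = ∫⁻ r in Ioo 0 (x - a), F r := by
  rw [← lintegral_indicator measurableSet_Ioo, ← lintegral_indicator measurableSet_Ioo,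
    ← lintegral_sub_left_eq_self (indicator (Ioo 0 (x - a)) F) x]
  apply lintegral_congr
  intro u
  simp only [indicator, mem_Ioo]
  have : (a < u ∧ u < x) ↔ (0 < x - u ∧ x - u < x - a) := by
    constructor <;> rintro ⟨h1, h2⟩ <;> constructor <;> linarith
  simp only [this]

lemma aux_rpow (p d : ℝ) (hp : -1 < p) (hd : 0 ≤ d) :
    ∫⁻ r in Ioo 0 d, ENNReal.ofReal (r ^ p) = ENNReal.ofReal (d ^ (p + 1) / (p + 1)) := by
  have hint := (intervalIntegral.intervalIntegrable_rpow' (a := 0) (b := d) hp)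
  rw [intervalIntegrable_iff_integrableOn_Ioo_of_le hd] at hint
  rw [← ofReal_integral_eq_lintegral_ofReal hint, ← integral_Ioc_eq_integral_Ioo,
    ← intervalIntegral.integral_of_le hd, integral_rpow (Or.inl hp),
    Real.zero_rpow (by linarith), sub_zero]
  filter_upwards [ae_restrict_mem measurableSet_Ioo] with r hr
  exact Real.rpow_nonneg hr.1.le _

lemma aux_rpow_Ioi (q d : ℝ) (hq : q < -1) (hd : 0 < d) :
    ∫⁻ r in Ioi d, ENNReal.ofReal (r ^ q) = ENNReal.ofReal (-d ^ (q + 1) / (q + 1)) := by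
  have hint := integrableOn_Ioi_rpow_of_lt hq hd
  rw [← ofReal_integral_eq_lintegral_ofReal hint, integral_Ioi_rpow_of_lt hq hd]
  filter_upwards [ae_restrict_mem measurableSet_Ioi] with r hr
  exact Real.rpow_nonneg (hd.le.trans (le_of_lt hr)) _

/-- the two kernel estimates -/
lemma aux_k2 (α t x : ℝ) (h0 : 0 < α) (hx : 0 < x) (hxt : x < t) :
    ∫⁻ s in Ioo 0 x, ENNReal.ofReal ((t - s) ^ (-1 - α))
      ≤ ENNReal.ofReal (1 / α) * ENNReal.ofReal ((t - x) ^ (-α)) := by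
  have e1 : ∫⁻ s in Ioo 0 x, ENNReal.ofReal ((t - s) ^ (-1 - α))
      = ∫⁻ r in Ioo 0 x, ENNReal.ofReal ((r + (t - x)) ^ (-1 - α)) := by
    have := aux_reflect (fun r => ENNReal.ofReal ((r + (t - x)) ^ (-1 - α))) 0 x
    rw [sub_zero] at this
    rw [← this]
    apply lintegral_congr; intro s; congr 2; ring
  rw [e1]
  have e2 : ∫⁻ r in Ioi 0, ENNReal.ofReal ((r + (t - x)) ^ (-1 - α))
      = ∫⁻ r in Ioi (t - x), ENNReal.ofReal (r ^ (-1 - α)) := by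
    rw [← lintegral_indicator measurableSet_Ioi, ← lintegral_indicator measurableSet_Ioi,
      ← lintegral_add_right_eq_self
        (indicator (Ioi (t - x)) fun r => ENNReal.ofReal (r ^ (-1 - α))) (t - x)]
    apply lintegral_congr
    intro u
    simp only [indicator, mem_Ioi]
    have : (0 < u) ↔ (t - x < u + (t - x)) := by
      constructor <;> intro h <;> linarith
    simp only [this]
  calc _ ≤ ∫⁻ r in Ioi 0, ENNReal.ofReal ((r + (t - x)) ^ (-1 - α)) :=
        lintegral_mono_set Ioo_subset_Ioi_self
    _ = _ := e2
    _ = _ := aux_rpow_Ioi _ _ (by linarith) (by linarith)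
    _ ≤ _ := by
        rw [← ENNReal.ofReal_mul (by positivity)]
        apply le_of_eq; congr 1
        have : -1 - α + 1 = -α := by ring
        rw [this]; field_simp

lemma aux_k1 (α t x : ℝ) (h0 : 0 < α) (h1 : α < 1) (hx : 0 < x) (hxt : x < t) :
    ∫⁻ s in Ioo 0 x, ENNReal.ofReal ((t - s) ^ (-1 - α)) * ENNReal.ofReal ((x - s) ^ (-α))
      ≤ ENNReal.ofReal (1 / (1 - α) + 1 / (2 * α)) * ENNReal.ofReal ((t - x) ^ (-(2 * α))) := by
  set d := t - x with hd
  have hdp : 0 < d := by linarith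
  have e1 : ∫⁻ s in Ioo 0 x, ENNReal.ofReal ((t - s) ^ (-1 - α)) * ENNReal.ofReal ((x - s) ^ (-α))
      = ∫⁻ r in Ioo 0 x, ENNReal.ofReal ((r + d) ^ (-1 - α)) * ENNReal.ofReal (r ^ (-α)) := by
    have := aux_reflect
      (fun r => ENNReal.ofReal ((r + d) ^ (-1 - α)) * ENNReal.ofReal (r ^ (-α))) 0 x
    rw [sub_zero] at this
    rw [← this]
    apply lintegral_congr; intro s; congr 3; rw [hd]; ring
  rw [e1]
  have hsub : Ioo 0 x ⊆ Ioo 0 d ∪ Ici d := by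
    intro r hr
    rcases lt_or_ge r d with h | h
    · exact Or.inl ⟨hr.1, h⟩
    · exact Or.inr h
  have b1 : ∫⁻ r in Ioo 0 d, ENNReal.ofReal ((r + d) ^ (-1 - α)) * ENNReal.ofReal (r ^ (-α))
      ≤ ENNReal.ofReal (1 / (1 - α) * d ^ (-(2 * α))) := by
    calc _ ≤ ∫⁻ r in Ioo 0 d, ENNReal.ofReal (d ^ (-1 - α)) * ENNReal.ofReal (r ^ (-α)) := by
          apply setLIntegral_mono' measurableSet_Ioo
          intro r hr
          gcongr ENNReal.ofReal ?_ * _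
          exact Real.rpow_le_rpow_of_nonpos hdp (by linarith [hr.1]) (by linarith)
      _ = ENNReal.ofReal (d ^ (-1 - α)) * ENNReal.ofReal (d ^ (-α + 1) / (-α + 1)) := by
          rw [lintegral_const_mul' _ _ ENNReal.ofReal_ne_top, aux_rpow _ _ (by linarith) hdp.le]
      _ ≤ _ := by
          rw [← ENNReal.ofReal_mul (by positivity)]
          apply le_of_eq; congr 1
          rw [← mul_div_assoc, ← Real.rpow_add hdp]
          have : -1 - α + (-α + 1) = -(2 * α) := by ring
          rw [this, show -α + 1 = 1 - α by ring]; ring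
  have b2 : ∫⁻ r in Ici d, ENNReal.ofReal ((r + d) ^ (-1 - α)) * ENNReal.ofReal (r ^ (-α))
      ≤ ENNReal.ofReal (1 / (2 * α) * d ^ (-(2 * α))) := by
    rw [setLIntegral_congr Ioi_ae_eq_Ici.symm]
    calc _ ≤ ∫⁻ r in Ioi d, ENNReal.ofReal (r ^ (-1 - 2 * α)) := by
          apply setLIntegral_mono' measurableSet_Ioi
          intro r hr
          have hr0 : 0 < r := hdp.trans hr
          rw [← ENNReal.ofReal_mul (by positivity)]
          apply ENNReal.ofReal_le_ofReal
          calc _ ≤ r ^ (-1 - α) * r ^ (-α) := by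
                gcongr ?_ * _
                exact Real.rpow_le_rpow_of_nonpos hr0 (by linarith) (by linarith)
            _ = _ := by rw [← Real.rpow_add hr0]; congr 1; ring
      _ = _ := aux_rpow_Ioi _ _ (by linarith) hdp
      _ ≤ _ := by
          apply le_of_eq; congr 1
          have : -1 - 2 * α + 1 = -(2 * α) := by ring
          rw [this]; field_simp
  have ha : 0 < 1 - α := by linarith
  calc _ ≤ _ := lintegral_mono_set hsub
    _ ≤ _ := lintegral_union_le _ _ _
    _ ≤ _ := add_le_add b1 b2
    _ = _ := by
      rw [← ENNReal.ofReal_add (by positivity) (by positivity), ← ENNReal.ofReal_mul (by positivity)]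
      congr 1; ring

lemma aux_zero (α t : ℝ) (g : ℝ → ℝ) (hfin : zeroNorm α 0 t g < ⊤) (u v : ℝ) (hu : 0 ≤ u)
    (huv : u < v) (hv : v < t) :
    |g v - g u| / (v - u) ^ (1 - α) + ∫ z in Ioo u v, |g u - g z| / (z - u) ^ (2 - α)
      ≤ (zeroNorm α 0 t g).toReal := by
  rw [← ENNReal.ofReal_le_iff_le_toReal hfin.ne]
  unfold zeroNorm
  exact le_iSup_of_le u <| le_iSup_of_le v <| le_iSup_of_le hu <| le_iSup_of_le huv <|
    le_iSup_of_le hv le_rfl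

lemma aux_fM (α t : ℝ) (h0 : 0 < α) (h1 : α < 1) (g : ℝ → ℝ) (hg : ContinuousOn g (Icc 0 t))
    (hfin : zeroNorm α 0 t g < ⊤) (x : ℝ) (hx0 : 0 < x) (hxt : x < t) :
    |fracDerivM α t g x| ≤ 2 / Real.Gamma α * (zeroNorm α 0 t g).toReal := by
  set L := (zeroNorm α 0 t g).toReal with hL
  have hL0 : 0 ≤ L := ENNReal.toReal_nonneg
  have hI0 : ∀ v, 0 ≤ ∫ z in Ioo x v, |g x - g z| / (z - x) ^ (2 - α) := by
    intro v
    apply setIntegral_nonneg measurableSet_Ioo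
    intro z hz
    have : 0 < z - x := by linarith [hz.1]
    positivity
  have hev : ∀ᶠ v in nhdsWithin t (Iio t), v ∈ Ioo x t := Ioo_mem_nhdsLT hxt
  have hA : |g t - g x| / (t - x) ^ (1 - α) ≤ L := by
    have hgt : Filter.Tendsto g (nhdsWithin t (Iio t)) (nhds (g t)) := by
      have := (hg t ⟨by linarith, le_rfl⟩).mono_left (nhdsWithin_mono t
        (show Ioo 0 t ⊆ Icc 0 t from Ioo_subset_Icc_self))
      rwa [nhdsWithin_Ioo_eq_nhdsLT (by linarith)] at this
    have hden : Filter.Tendsto (fun v : ℝ => (v - x) ^ (1 - α)) (nhdsWithin t (Iio t))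
        (nhds ((t - x) ^ (1 - α))) := by
      have : ContinuousAt (fun v : ℝ => (v - x) ^ (1 - α)) t := by
        apply ContinuousAt.rpow_const (by fun_prop)
        exact Or.inl (sub_pos.2 hxt).ne'
      exact this.tendsto.mono_left nhdsWithin_le_nhds
    have hpos : 0 < (t - x) ^ (1 - α) := Real.rpow_pos_of_pos (by linarith) _
    refine le_of_tendsto (((hgt.sub_const (g x)).abs).div hden hpos.ne') ?_
    filter_upwards [hev] with v hv
    have := aux_zero α t g hfin x v hx0.le hv.1 hv.2
    have h4 := hI0 v
    change |g v - g x| / (v - x) ^ (1 - α) ≤ L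
    linarith
  have hB : |∫ u in Ioo x t, (g x - g u) / (u - x) ^ (2 - α)| ≤ L := by
    by_cases hint : IntegrableOn (fun u => (g x - g u) / (u - x) ^ (2 - α)) (Ioo x t)
    · calc _ ≤ ∫ u in Ioo x t, |(g x - g u) / (u - x) ^ (2 - α)| := abs_integral_le_integral_abs
        _ = ∫ u in Ioo x t, |g x - g u| / (u - x) ^ (2 - α) := by
          apply setIntegral_congr_fun measurableSet_Ioo
          intro z hz
          have : 0 < z - x := by linarith [hz.1]
          simp only [abs_div]
          rw [abs_of_nonneg (a := (z - x) ^ (2 - α)) (by positivity)]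
        _ ≤ L := by
          have hint' : IntegrableOn (fun u => |g x - g u| / (u - x) ^ (2 - α)) (Ioo x t) := by
            refine IntegrableOn.congr_fun (Integrable.abs hint) ?_ measurableSet_Ioo
            intro z hz
            have : 0 < z - x := by linarith [hz.1]
            simp only [abs_div]
            rw [abs_of_nonneg (a := (z - x) ^ (2 - α)) (by positivity)]
          have hII : IntervalIntegrable (fun u => |g x - g u| / (u - x) ^ (2 - α)) volume x t := by
            rwa [intervalIntegrable_iff_integrableOn_Ioo_of_le hxt.le]
          have hc := intervalIntegral.continuousOn_primitive_interval (a := x) (b := t)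
            (f := fun u => |g x - g u| / (u - x) ^ (2 - α)) (μ := volume) (by
              rw [uIcc_of_le hxt.le, integrableOn_Icc_iff_integrableOn_Ioo]; exact hint')
          rw [uIcc_of_le hxt.le] at hc
          have hlim := (hc t ⟨hxt.le, le_rfl⟩).mono_left (nhdsWithin_mono t
            (show Ioo x t ⊆ Icc x t from Ioo_subset_Icc_self))
          rw [nhdsWithin_Ioo_eq_nhdsLT hxt] at hlim
          have := le_of_tendsto (b := L) hlim (by
            filter_upwards [hev] with v hv
            have := aux_zero α t g hfin x v hx0.le hv.1 hv.2
            rw [intervalIntegral.integral_of_le hv.1.le, integral_Ioc_eq_integral_Ioo]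
            have h3 : 0 ≤ |g v - g x| / (v - x) ^ (1 - α) := by
              have : 0 < v - x := by linarith [hv.1]
              positivity
            linarith)
          beta_reduce at this
          rwa [intervalIntegral.integral_of_le hxt.le, integral_Ioc_eq_integral_Ioo] at this
    · rw [integral_undef hint]; simpa using hL0
  have hG : 0 < Real.Gamma α := Real.Gamma_pos_of_pos h0
  unfold fracDerivM
  rw [abs_mul, abs_of_pos (by positivity : 0 < 1 / Real.Gamma α)]
  have hA' : |(g x - g t) / (t - x) ^ (1 - α)| ≤ L := by
    have : 0 < t - x := by linarith
    rw [abs_div, abs_sub_comm, abs_of_nonneg (a := (t - x) ^ (1 - α)) (by positivity)]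
    exact hA
  have hB' : |(1 - α) * ∫ u in Ioo x t, (g x - g u) / (u - x) ^ (2 - α)| ≤ L := by
    rw [abs_mul, abs_of_pos (by linarith : 0 < 1 - α)]
    nlinarith [abs_nonneg (∫ u in Ioo x t, (g x - g u) / (u - x) ^ (2 - α))]
  calc _ ≤ 1 / Real.Gamma α * (L + L) := by
        gcongr
        exact (abs_add_le _ _).trans (add_le_add hA' hB')
    _ = _ := by ring

lemma aux_fP (α β t M : ℝ) (h0 : 0 < α) (h1 : α < 1) (hβ : α < β) (hM : 0 < M)
    (c : ℝ → ℝ → ℝ) (X : ℝ → ℝ)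
    (hc1 : ∀ s ∈ Set.Icc 0 t, ∀ x : ℝ, |c s x| ≤ M * (1 + |x|))
    (hc2 : ∀ s ∈ Set.Icc 0 t, ∀ u ∈ Set.Icc 0 t, ∀ x y : ℝ,
        |c s x - c u y| ≤ M * (|s - u| ^ β + |x - y|))
    (s x : ℝ) (hs : 0 < s) (hsx : s < x) (hxt : x < t) :
    ENNReal.ofReal |fracDerivP α s (fun u => c u (X u)) x| ≤
      ENNReal.ofReal (1 / Real.Gamma (1 - α) * (M * (1 + t ^ β / (β - α)))) *
        (ENNReal.ofReal ((1 + |X x|) * (x - s) ^ (-α)) + pathNorm α X x) := by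
  have hG : 0 < Real.Gamma (1 - α) := Real.Gamma_pos_of_pos (by linarith)
  have hxs : 0 < x - s := by linarith
  have ht : 0 < t := by linarith
  have hba : 0 < β - α := by linarith
  set P := ENNReal.ofReal ((1 + |X x|) * (x - s) ^ (-α)) with hP
  set B := t ^ β / (β - α) with hB
  have hB0 : 0 ≤ B := by positivity
  set N := pathNorm α X x with hN
  have hxm : x ∈ Icc 0 t := ⟨by linarith, hxt.le⟩
  have t1 : ENNReal.ofReal |c x (X x) / (x - s) ^ α| ≤ ENNReal.ofReal M * P := by
    rw [hP, ← ENNReal.ofReal_mul hM.le]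
    apply ENNReal.ofReal_le_ofReal
    rw [abs_div, abs_of_nonneg (a := (x - s) ^ α) (by positivity), Real.rpow_neg hxs.le,
      ← mul_assoc, div_eq_mul_inv]
    gcongr
    exact hc1 x hxm _
  have t2 : ENNReal.ofReal |∫ u in Ioo s x, (c x (X x) - c u (X u)) / (x - u) ^ (1 + α)| ≤
      ENNReal.ofReal M * (ENNReal.ofReal B * P + N) := by
    rw [← Real.enorm_eq_ofReal_abs]
    calc _ ≤ _ := enorm_integral_le_lintegral_enorm _
      _ ≤ ∫⁻ u in Ioo s x, ENNReal.ofReal M * (ENNReal.ofReal ((x - u) ^ (β - 1 - α))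
            + ENNReal.ofReal (|X x - X u| * (x - u) ^ (-1 - α))) := by
          apply setLIntegral_mono' measurableSet_Ioo
          intro u hu
          have hxu : 0 < x - u := by linarith [hu.2]
          rw [Real.enorm_eq_ofReal_abs, ← ENNReal.ofReal_add (by positivity) (by positivity),
            ← ENNReal.ofReal_mul hM.le]
          apply ENNReal.ofReal_le_ofReal
          rw [abs_div, abs_of_nonneg (a := (x - u) ^ (1 + α)) (by positivity)]
          have := hc2 x hxm u ⟨by linarith [hu.1], by linarith [hu.2]⟩ (X x) (X u)
          rw [abs_of_pos hxu] at this
          have e : (x - u) ^ (β - 1 - α) = (x - u) ^ β * (x - u) ^ (-1 - α) := by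
            rw [← Real.rpow_add hxu]; congr 1; ring
          have e' : (x - u) ^ (1 + α) = ((x - u) ^ (-1 - α))⁻¹ := by
            rw [← Real.rpow_neg hxu.le]; congr 1; ring
          rw [e, e', div_inv_eq_mul, ← add_mul, ← mul_assoc]
          gcongr
      _ = ENNReal.ofReal M * ((∫⁻ u in Ioo s x, ENNReal.ofReal ((x - u) ^ (β - 1 - α)))
            + ∫⁻ u in Ioo s x, ENNReal.ofReal (|X x - X u| * (x - u) ^ (-1 - α))) := by
          rw [lintegral_const_mul' _ _ ENNReal.ofReal_ne_top, lintegral_add_left (by fun_prop)]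
      _ ≤ _ := by
          gcongr
          · rw [aux_reflect (fun r => ENNReal.ofReal (r ^ (β - 1 - α))),
              aux_rpow _ _ (by linarith) hxs.le, hP, ← ENNReal.ofReal_mul hB0]
            apply ENNReal.ofReal_le_ofReal
            have e : (x - s) ^ (β - 1 - α + 1) = (x - s) ^ β * (x - s) ^ (-α) := by
              rw [← Real.rpow_add hxs]; congr 1; ring
            have e2 : (x - s) ^ β ≤ t ^ β := Real.rpow_le_rpow hxs.le (by linarith) (by linarith)
            rw [e, hB, show β - 1 - α + 1 = β - α by ring]
            calc _ = (x - s) ^ β / (β - α) * (1 * (x - s) ^ (-α)) := by ring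
              _ ≤ _ := by gcongr; linarith [abs_nonneg (X x)]
          · rw [hN]; unfold pathNorm
            exact lintegral_mono_set (Ioo_subset_Ioo_left hs.le)
  unfold fracDerivP
  rw [abs_mul, abs_of_pos (by positivity : 0 < 1 / Real.Gamma (1 - α)),
    ENNReal.ofReal_mul (by positivity), ENNReal.ofReal_mul (q := M * (1 + B)) (by positivity),
    mul_assoc]
  gcongr
  calc _ ≤ ENNReal.ofReal (|c x (X x) / (x - s) ^ α|
          + |∫ u in Ioo s x, (c x (X x) - c u (X u)) / (x - u) ^ (1 + α)|) := by
        apply ENNReal.ofReal_le_ofReal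
        refine (abs_add_le _ _).trans ?_
        refine add_le_add le_rfl ?_
        rw [abs_mul, abs_of_pos h0]
        exact mul_le_of_le_one_left (abs_nonneg _) h1.le
    _ ≤ ENNReal.ofReal M * P + ENNReal.ofReal M * (ENNReal.ofReal B * P + N) := by
        rw [ENNReal.ofReal_add (abs_nonneg _) (abs_nonneg _)]
        exact add_le_add t1 t2
    _ ≤ ENNReal.ofReal M * P + ENNReal.ofReal M * (ENNReal.ofReal B * P + N)
         + ENNReal.ofReal M * ENNReal.ofReal B * N := le_self_add
    _ = _ := by
        rw [ENNReal.ofReal_mul hM.le, ENNReal.ofReal_add zero_le_one hB0, ENNReal.ofReal_one]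
        ring

lemma aux_path_meas (α : ℝ) (X : ℝ → ℝ) (hX : Measurable X) : Measurable (pathNorm α X) := by
  have : pathNorm α X = fun s => ∫⁻ u, (({p : ℝ × ℝ | 0 < p.2 ∧ p.2 < p.1}).indicator
      (fun p => ENNReal.ofReal (|X p.1 - X p.2| * (p.1 - p.2) ^ (-1 - α)))) (s, u) := by
    funext s
    unfold pathNorm
    rw [← lintegral_indicator measurableSet_Ioo]
    rfl
  rw [this]
  apply Measurable.lintegral_prod_right'
  apply Measurable.indicator
  · fun_prop
  · exact (measurableSet_lt measurable_const measurable_snd).inter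
      (measurableSet_lt measurable_snd measurable_fst)

lemma aux_tonelli (t : ℝ) (H : ℝ → ℝ → ℝ≥0∞) (hH : Measurable (Function.uncurry H)) :
    ∫⁻ s in Ioo 0 t, ∫⁻ x in Ioo s t, H s x = ∫⁻ x in Ioo 0 t, ∫⁻ s in Ioo 0 x, H s x := by
  have hS : MeasurableSet {p : ℝ × ℝ | 0 < p.1 ∧ p.1 < p.2 ∧ p.2 < t} :=
    (measurableSet_lt measurable_const measurable_fst).inter
      ((measurableSet_lt measurable_fst measurable_snd).inter
        (measurableSet_lt measurable_snd measurable_const))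
  set S := {p : ℝ × ℝ | 0 < p.1 ∧ p.1 < p.2 ∧ p.2 < t} with hSd
  have l : ∫⁻ s in Ioo 0 t, ∫⁻ x in Ioo s t, H s x
      = ∫⁻ s, ∫⁻ x, S.indicator (Function.uncurry H) (s, x) := by
    rw [← lintegral_indicator measurableSet_Ioo]
    apply lintegral_congr; intro s
    by_cases hs : s ∈ Ioo 0 t
    · rw [indicator_of_mem hs, ← lintegral_indicator measurableSet_Ioo]
      apply lintegral_congr; intro x
      by_cases hx : x ∈ Ioo s t
      · rw [indicator_of_mem hx, indicator_of_mem (show (s, x) ∈ S from ⟨hs.1, hx.1, hx.2⟩)]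
        rfl
      · rw [indicator_of_notMem hx, indicator_of_notMem]
        exact fun h => hx ⟨h.2.1, h.2.2⟩
    · rw [indicator_of_notMem hs]
      symm
      rw [lintegral_eq_zero_of_ae_eq_zero]
      refine Filter.Eventually.of_forall fun x => ?_
      refine indicator_of_notMem ?_ _
      exact fun h => hs ⟨h.1, h.2.1.trans h.2.2⟩
  have r : ∫⁻ x in Ioo 0 t, ∫⁻ s in Ioo 0 x, H s x
      = ∫⁻ x, ∫⁻ s, S.indicator (Function.uncurry H) (s, x) := by
    rw [← lintegral_indicator measurableSet_Ioo]
    apply lintegral_congr; intro x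
    by_cases hx : x ∈ Ioo 0 t
    · rw [indicator_of_mem hx, ← lintegral_indicator measurableSet_Ioo]
      apply lintegral_congr; intro s
      by_cases hs : s ∈ Ioo 0 x
      · rw [indicator_of_mem hs, indicator_of_mem (show (s, x) ∈ S from ⟨hs.1, hs.2, hx.2⟩)]
        rfl
      · rw [indicator_of_notMem hs, indicator_of_notMem]
        exact fun h => hs ⟨h.1, h.2.1⟩
    · rw [indicator_of_notMem hx]
      symm
      rw [lintegral_eq_zero_of_ae_eq_zero]
      refine Filter.Eventually.of_forall fun s => ?_
      refine indicator_of_notMem ?_ _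
      exact fun h => hx ⟨h.1.trans h.2.1, h.2.2⟩
  rw [l, r]
  exact lintegral_lintegral_swap (f := fun s x => S.indicator (Function.uncurry H) (s, x))
    (hH.indicator hS).aemeasurable

theorem gls_integral_tail_bound (α β t M : ℝ)
    (hα : α ∈ Set.Ioo (0 : ℝ) (1 / 2)) (hβ : β ∈ Set.Ioo α 1)
    (ht : 0 < t) (hM : 0 < M) :
    ∃ C : ℝ, 0 < C ∧ ∀ (c : ℝ → ℝ → ℝ) (g X : ℝ → ℝ),
      (∀ s ∈ Set.Icc 0 t, ∀ x : ℝ, |c s x| ≤ M * (1 + |x|)) →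
      (∀ s ∈ Set.Icc 0 t, ∀ u ∈ Set.Icc 0 t, ∀ x y : ℝ,
        |c s x - c u y| ≤ M * (|s - u| ^ β + |x - y|)) →
      ContinuousOn g (Set.Icc 0 t) →
      zeroNorm α 0 t g < ⊤ →
      Measurable X →
      (∫⁻ u in Ioo (0 : ℝ) t,
          (ENNReal.ofReal (|X u| * (t - u) ^ (-(2 * α)))
            + pathNorm α X u * ENNReal.ofReal ((t - u) ^ (-α)))) < ⊤ →
      (∫⁻ s in Ioo (0 : ℝ) t,
          ENNReal.ofReal
            (|glsIntegral α s t (fun u => c u (X u)) g| * (t - s) ^ (-1 - α))) ≤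
        ENNReal.ofReal
          (C * (zeroNorm α 0 t g).toReal *
            (1 + (∫⁻ u in Ioo (0 : ℝ) t,
              (ENNReal.ofReal (|X u| * (t - u) ^ (-(2 * α)))
                + pathNorm α X u * ENNReal.ofReal ((t - u) ^ (-α)))).toReal)) := by
  obtain ⟨h0, h1⟩ := hα
  obtain ⟨hβ1, hβ2⟩ := hβ
  have h1' : α < 1 := by linarith
  have hG1 : 0 < Real.Gamma α := Real.Gamma_pos_of_pos h0
  have hG2 : 0 < Real.Gamma (1 - α) := Real.Gamma_pos_of_pos (by linarith)
  have hba : 0 < β - α := by linarith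
  have h1a : 0 < 1 - α := by linarith
  have h2a : 0 < 1 - 2 * α := by linarith
  obtain ⟨K1, hK1⟩ : ∃ K1, K1 = 2 / Real.Gamma α := ⟨_, rfl⟩
  obtain ⟨K2, hK2⟩ : ∃ K2, K2 = 1 / Real.Gamma (1 - α) * (M * (1 + t ^ β / (β - α))) := ⟨_, rfl⟩
  obtain ⟨D1, hD1⟩ : ∃ D1, D1 = 1 / (1 - α) + 1 / (2 * α) := ⟨_, rfl⟩
  obtain ⟨D2, hD2⟩ : ∃ D2, D2 = 1 / α := ⟨_, rfl⟩
  obtain ⟨E, hE⟩ : ∃ E, E = t ^ (1 - 2 * α) / (1 - 2 * α) := ⟨_, rfl⟩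
  have pK1 : 0 < K1 := by rw [hK1]; positivity
  have pK2 : 0 < K2 := by rw [hK2]; positivity
  have pD1 : 0 < D1 := by rw [hD1]; positivity
  have pD2 : 0 < D2 := by rw [hD2]; positivity
  have pE : 0 < E := by rw [hE]; positivity
  refine ⟨K1 * K2 * ((D1 + D2) * (E + 1)), by positivity, ?_⟩
  intro c g X hc1 hc2 hg hfin hX hI
  set L := (zeroNorm α 0 t g).toReal with hL
  have hL0 : 0 ≤ L := ENNReal.toReal_nonneg
  set I := ∫⁻ u in Ioo (0 : ℝ) t,
          (ENNReal.ofReal (|X u| * (t - u) ^ (-(2 * α)))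
            + pathNorm α X u * ENNReal.ofReal ((t - u) ^ (-α))) with hIdef
  have hpm := aux_path_meas α X hX
  have step1 : ∀ s ∈ Ioo 0 t, ENNReal.ofReal
      (|glsIntegral α s t (fun u => c u (X u)) g| * (t - s) ^ (-1 - α)) ≤
      ENNReal.ofReal (K1 * K2 * L) * ∫⁻ x in Ioo s t, ENNReal.ofReal ((t - s) ^ (-1 - α)) *
        (ENNReal.ofReal ((1 + |X x|) * (x - s) ^ (-α)) + pathNorm α X x) := by
    intro s hs
    rw [lintegral_const_mul' _ _ ENNReal.ofReal_ne_top, ENNReal.ofReal_mul (abs_nonneg _)]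
    have : ENNReal.ofReal |glsIntegral α s t (fun u => c u (X u)) g| ≤
        ENNReal.ofReal (K1 * K2 * L) * ∫⁻ x in Ioo s t,
        (ENNReal.ofReal ((1 + |X x|) * (x - s) ^ (-α)) + pathNorm α X x) := by
      unfold glsIntegral
      rw [← lintegral_const_mul' _ _ ENNReal.ofReal_ne_top, ← Real.enorm_eq_ofReal_abs]
      refine (enorm_integral_le_lintegral_enorm _).trans ?_
      apply setLIntegral_mono' measurableSet_Ioo
      intro x hx
      rw [Real.enorm_eq_ofReal_abs, abs_mul, ENNReal.ofReal_mul (abs_nonneg _)]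
      have hP := aux_fP α β t M h0 h1' hβ1 hM c X hc1 hc2 s x hs.1 hx.1 hx.2
      have hMM := aux_fM α t h0 h1' g hg hfin x (hs.1.trans hx.1) hx.2
      rw [← hK2] at hP
      rw [← hK1] at hMM
      refine (mul_le_mul' hP (ENNReal.ofReal_le_ofReal hMM)).trans (le_of_eq ?_)
      rw [← hL, ENNReal.ofReal_mul pK1.le, ENNReal.ofReal_mul (mul_pos pK1 pK2).le,
        ENNReal.ofReal_mul pK1.le]
      ring
    calc _ ≤ _ := mul_le_mul_left this _
      _ = _ := by ring
  have step2 : ∀ x ∈ Ioo 0 t, ∫⁻ s in Ioo 0 x, ENNReal.ofReal ((t - s) ^ (-1 - α)) *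
        (ENNReal.ofReal ((1 + |X x|) * (x - s) ^ (-α)) + pathNorm α X x) ≤
      ENNReal.ofReal (D1 + D2) * (ENNReal.ofReal ((t - x) ^ (-(2 * α))) +
        (ENNReal.ofReal (|X x| * (t - x) ^ (-(2 * α)))
          + pathNorm α X x * ENNReal.ofReal ((t - x) ^ (-α)))) := by
    intro x hx
    have htx : 0 < t - x := by linarith [hx.2]
    have hk1 := aux_k1 α t x h0 h1' hx.1 hx.2
    have hk2 := aux_k2 α t x h0 hx.1 hx.2
    rw [← hD1] at hk1
    rw [← hD2] at hk2
    have e : ∫⁻ s in Ioo 0 x, ENNReal.ofReal ((t - s) ^ (-1 - α)) *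
        (ENNReal.ofReal ((1 + |X x|) * (x - s) ^ (-α)) + pathNorm α X x)
        = ENNReal.ofReal (1 + |X x|) * (∫⁻ s in Ioo 0 x, ENNReal.ofReal ((t - s) ^ (-1 - α)) *
          ENNReal.ofReal ((x - s) ^ (-α)))
          + pathNorm α X x * ∫⁻ s in Ioo 0 x, ENNReal.ofReal ((t - s) ^ (-1 - α)) := by
      rw [← lintegral_const_mul _ (by fun_prop), ← lintegral_const_mul _ (by fun_prop),
        ← lintegral_add_left (by fun_prop)]
      apply lintegral_congr; intro s
      rw [ENNReal.ofReal_mul (by positivity)]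
      ring
    rw [e]
    have d1 : ENNReal.ofReal D1 ≤ ENNReal.ofReal (D1 + D2) :=
      ENNReal.ofReal_le_ofReal (by linarith)
    have d2 : ENNReal.ofReal D2 ≤ ENNReal.ofReal (D1 + D2) :=
      ENNReal.ofReal_le_ofReal (by linarith)
    calc _ ≤ ENNReal.ofReal (1 + |X x|) * (ENNReal.ofReal (D1 + D2)
              * ENNReal.ofReal ((t - x) ^ (-(2 * α))))
            + pathNorm α X x * (ENNReal.ofReal (D1 + D2) * ENNReal.ofReal ((t - x) ^ (-α))) := by
          gcongr
          · exact hk1.trans (by gcongr)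
          · exact hk2.trans (by gcongr)
      _ = _ := by
          rw [ENNReal.ofReal_add zero_le_one (abs_nonneg _), ENNReal.ofReal_one,
            ENNReal.ofReal_mul (abs_nonneg _)]
          ring
  have hE' : ∫⁻ x in Ioo 0 t, ENNReal.ofReal ((t - x) ^ (-(2 * α))) = ENNReal.ofReal E := by
    rw [aux_reflect (fun r => ENNReal.ofReal (r ^ (-(2 * α)))), aux_rpow _ _ (by linarith)
      (by linarith), hE, sub_zero, show -(2 * α) + 1 = 1 - 2 * α by ring]
  calc _ ≤ ∫⁻ s in Ioo 0 t, ENNReal.ofReal (K1 * K2 * L) * ∫⁻ x in Ioo s t,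
        ENNReal.ofReal ((t - s) ^ (-1 - α)) *
        (ENNReal.ofReal ((1 + |X x|) * (x - s) ^ (-α)) + pathNorm α X x) :=
        setLIntegral_mono' measurableSet_Ioo step1
    _ = ENNReal.ofReal (K1 * K2 * L) * ∫⁻ x in Ioo 0 t, ∫⁻ s in Ioo 0 x,
        ENNReal.ofReal ((t - s) ^ (-1 - α)) *
        (ENNReal.ofReal ((1 + |X x|) * (x - s) ^ (-α)) + pathNorm α X x) := by
        rw [lintegral_const_mul' _ _ ENNReal.ofReal_ne_top]
        congr 1
        apply aux_tonelli t (fun s x => ENNReal.ofReal ((t - s) ^ (-1 - α)) *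
          (ENNReal.ofReal ((1 + |X x|) * (x - s) ^ (-α)) + pathNorm α X x))
        unfold Function.uncurry
        fun_prop
    _ ≤ ENNReal.ofReal (K1 * K2 * L) * ∫⁻ x in Ioo 0 t,
        ENNReal.ofReal (D1 + D2) * (ENNReal.ofReal ((t - x) ^ (-(2 * α))) +
        (ENNReal.ofReal (|X x| * (t - x) ^ (-(2 * α)))
          + pathNorm α X x * ENNReal.ofReal ((t - x) ^ (-α)))) := by
        gcongr 1
        exact setLIntegral_mono' measurableSet_Ioo step2
    _ = ENNReal.ofReal (K1 * K2 * L) * (ENNReal.ofReal (D1 + D2) * (ENNReal.ofReal E + I)) := by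
        rw [lintegral_const_mul' _ _ ENNReal.ofReal_ne_top, lintegral_add_left (by fun_prop), hE']
    _ = ENNReal.ofReal (K1 * K2 * L * ((D1 + D2) * (E + I.toReal))) := by
        have : I = ENNReal.ofReal I.toReal := (ENNReal.ofReal_toReal hI.ne).symm
        rw [ENNReal.ofReal_mul (p := K1 * K2 * L) (by positivity),
          ENNReal.ofReal_mul (p := D1 + D2) (by positivity), ENNReal.ofReal_add pE.le ENNReal.toReal_nonneg, ← this]
    _ ≤ _ := by
        apply ENNReal.ofReal_le_ofReal
        have hI0 : 0 ≤ I.toReal := ENNReal.toReal_nonneg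
        have : E + I.toReal ≤ (E + 1) * (1 + I.toReal) := by nlinarith
        calc _ ≤ K1 * K2 * L * ((D1 + D2) * ((E + 1) * (1 + I.toReal))) := by gcongr
          _ = _ := by ring
end

section
/- (Pathwise estimate for the mixed equation, deterministic form of Lemma 4.1.) Let α ∈ (0,1/2), β ∈ (α,1), T > 0, M > 0, and let a, c : [0,T] × ℝ → ℝ satisfy, for all s,t ∈ [0,T] and x,y ∈ ℝ: |a(t,x)| + |c(t,x)| ≤ M(1+|x|), |a(t,x) − a(t,y)| + |c(t,x) − c(t,y)| ≤ M|x−y|, and |a(s,x) − a(t,x)| + |c(s,x) − c(t,x)| ≤ M|s−t|^β. Let g : [0,T] → ℝ be continuous with Λ := ‖g‖_{0;[0,T]} < ∞, let F : [0,T] → ℝ be measurable with F(0) = 0 and ‖F‖_{∞;T} < ∞, and let X : [0,T] → ℝ be measurable with ‖X‖_{∞;T} < ∞ and satisfy, for all t ∈ [0,T], X_t = X_0 + ∫_0^t a(s,X_s) ds + F(t) + ∫_0^t c(s,X_s) dg(s), the last integral being the generalized Lebesgue–Stieltjes integral. Then there is a constant C, depending only on α, β, M and T (but not on g, F or X), such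 that ‖X‖_{∞;T} ≤ C (1 + |X_0|) exp{ C Λ^{1/(1−α)} } ( 1 + ‖F‖_{∞;T} ). -/
open MeasureTheory Set
open scoped ENNReal

/-- `‖f‖_{∞;T} = sup_{s ≤ T} |f s| + sup_{s ≤ T} ‖f‖_s`, valued in `ℝ≥0∞`. -/
noncomputable def supNorm (α T : ℝ) (f : ℝ → ℝ) : ℝ≥0∞ :=
  (⨆ (s : ℝ) (_ : s ∈ Set.Icc (0 : ℝ) T), ENNReal.ofReal |f s|) +
    ⨆ (s : ℝ) (_ : s ∈ Set.Icc (0 : ℝ) T), pathNorm α f s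


lemma lint_left {p x t : ℝ} (hp : p < 1) (hxt : x ≤ t) :
    ∫⁻ s in Ioo x t, ENNReal.ofReal ((s - x) ^ (-p)) = ENNReal.ofReal ((t - x) ^ (1 - p) / (1 - p)) := by
  have hi : IntervalIntegrable (fun s : ℝ => (s - x) ^ (-p)) volume x t := by
    have := (intervalIntegral.intervalIntegrable_rpow' (a := 0) (b := t - x) (r := -p) (by linarith)).comp_sub_right x
    simpa using this
  have h1 : ∫ s in Ioo x t, (s - x) ^ (-p) = (t - x) ^ (1 - p) / (1 - p) := by
    rw [← integral_Ioc_eq_integral_Ioo, ← intervalIntegral.integral_of_le hxt,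
      intervalIntegral.integral_comp_sub_right (fun s : ℝ => s ^ (-p)) x, sub_self,
      integral_rpow (Or.inl (by linarith)), Real.zero_rpow (by linarith)]
    ring_nf
  rw [← h1, ofReal_integral_eq_lintegral_ofReal]
  · exact ((intervalIntegrable_iff_integrableOn_Ioo_of_le hxt).1 hi)
  · filter_upwards [self_mem_ae_restrict measurableSet_Ioo] with s hs
    exact Real.rpow_nonneg (by linarith [hs.1]) _

lemma lint_right {p x t : ℝ} (hp : p < 1) (hxt : x ≤ t) :
    ∫⁻ s in Ioo x t, ENNReal.ofReal ((t - s) ^ (-p)) = ENNReal.ofReal ((t - x) ^ (1 - p) / (1 - p)) := by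
  have hi : IntervalIntegrable (fun s : ℝ => (t - s) ^ (-p)) volume x t := by
    have := (intervalIntegral.intervalIntegrable_rpow' (a := t - x) (b := 0) (r := -p) (by linarith)).comp_sub_left t
    simpa using this
  have h1 : ∫ s in Ioo x t, (t - s) ^ (-p) = (t - x) ^ (1 - p) / (1 - p) := by
    rw [← integral_Ioc_eq_integral_Ioo, ← intervalIntegral.integral_of_le hxt,
      intervalIntegral.integral_comp_sub_left (fun s : ℝ => s ^ (-p)) t, sub_self,
      integral_rpow (Or.inl (by linarith)), Real.zero_rpow (by linarith)]
    ring_nf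
  rw [← h1, ofReal_integral_eq_lintegral_ofReal]
  · exact ((intervalIntegrable_iff_integrableOn_Ioo_of_le hxt).1 hi)
  · filter_upwards [self_mem_ae_restrict measurableSet_Ioo] with s hs
    exact Real.rpow_nonneg (by linarith [hs.2]) _

lemma lint_far {α a x t : ℝ} (hα : 0 < α) (hax : a ≤ x) (hxt : x < t) :
    ∫⁻ s in Ioo a x, ENNReal.ofReal ((t - s) ^ (-1 - α)) ≤ ENNReal.ofReal ((t - x) ^ (-α) / α) := by
  have hn : (0:ℝ) ∉ uIcc (t - x) (t - a) := by
    rw [uIcc_of_le (by linarith)]; intro h; linarith [h.1]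
  have hi : IntervalIntegrable (fun s : ℝ => (t - s) ^ (-1 - α)) volume a x := by
    have := (intervalIntegral.intervalIntegrable_rpow (μ := volume) (a := t - a) (b := t - x) (r := -1 - α) (Or.inr (by rwa [uIcc_comm]))).comp_sub_left t
    simpa using this
  have h1 : ∫ s in Ioo a x, (t - s) ^ (-1 - α) = ((t - x) ^ (-α) - (t - a) ^ (-α)) / α := by
    rw [← integral_Ioc_eq_integral_Ioo, ← intervalIntegral.integral_of_le hax,
      intervalIntegral.integral_comp_sub_left (fun s : ℝ => s ^ (-1 - α)) t,
      integral_rpow (Or.inr ⟨by linarith, hn⟩)]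
    have : -1 - α + 1 = -α := by ring
    rw [this]; field_simp; ring
  rw [← ofReal_integral_eq_lintegral_ofReal, h1]
  · apply ENNReal.ofReal_le_ofReal
    gcongr
    have := Real.rpow_nonneg (by linarith : 0 ≤ t - a) (-α)
    linarith
  · exact ((intervalIntegrable_iff_integrableOn_Ioo_of_le hax).1 hi)
  · filter_upwards [self_mem_ae_restrict measurableSet_Ioo] with s hs
    exact Real.rpow_nonneg (by linarith [hs.2]) _

lemma lint_beta {p q : ℝ} (hp0 : 0 ≤ p) (hp : p < 1) (hq0 : 0 ≤ q) (hq : q < 1) :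
    ∃ C : ℝ, 0 < C ∧ ∀ x t : ℝ, x < t →
      ∫⁻ s in Ioo x t, ENNReal.ofReal ((t - s) ^ (-p) * (s - x) ^ (-q)) ≤
        ENNReal.ofReal (C * (t - x) ^ (1 - p - q)) := by
  refine ⟨2 ^ p / (1 - q) + 2 ^ q / (1 - p), ?_, ?_⟩
  · have := sub_pos.2 hp; have := sub_pos.2 hq; positivity
  intro x t hxt
  set L := t - x with hL
  have hL0 : 0 < L := by simp [hL, hxt]
  have hp1 := sub_pos.2 hp
  have hq1 := sub_pos.2 hq
  calc ∫⁻ s in Ioo x t, ENNReal.ofReal ((t - s) ^ (-p) * (s - x) ^ (-q))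
      ≤ ∫⁻ s in Ioo x t, (ENNReal.ofReal ((L / 2) ^ (-p)) * ENNReal.ofReal ((s - x) ^ (-q))
          + ENNReal.ofReal ((L / 2) ^ (-q)) * ENNReal.ofReal ((t - s) ^ (-p))) := by
        apply setLIntegral_mono' measurableSet_Ioo
        intro s hs
        have h1 : 0 < t - s := by linarith [hs.2]
        have h2 : 0 < s - x := by linarith [hs.1]
        have e1 := Real.rpow_nonneg h1.le (-p)
        have e2 := Real.rpow_nonneg h2.le (-q)
        have e3 : 0 ≤ (L / 2) ^ (-p) := by positivity
        have e4 : 0 ≤ (L / 2) ^ (-q) := by positivity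
        rw [← ENNReal.ofReal_mul e3, ← ENNReal.ofReal_mul e4, ← ENNReal.ofReal_add (by positivity) (by positivity)]
        apply ENNReal.ofReal_le_ofReal
        rcases le_total (L / 2) (t - s) with h | h
        · have := Real.rpow_le_rpow_of_nonpos (by positivity) h (neg_nonpos.2 hp0)
          have := mul_le_mul_of_nonneg_right this e2
          have := mul_nonneg e4 e1
          linarith
        · have h' : L / 2 ≤ s - x := by linarith
          have := Real.rpow_le_rpow_of_nonpos (by positivity) h' (neg_nonpos.2 hq0)
          have := mul_le_mul_of_nonneg_right this e1
          have := mul_nonneg e3 e2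
          linarith
    _ = ENNReal.ofReal ((L / 2) ^ (-p)) * ENNReal.ofReal (L ^ (1 - q) / (1 - q)) +
        ENNReal.ofReal ((L / 2) ^ (-q)) * ENNReal.ofReal (L ^ (1 - p) / (1 - p)) := by
        rw [lintegral_add_left (by fun_prop), lintegral_const_mul _ (by fun_prop),
          lintegral_const_mul _ (by fun_prop), lint_left hq hxt.le, lint_right hp hxt.le]
    _ ≤ _ := by
        rw [← ENNReal.ofReal_mul (by positivity), ← ENNReal.ofReal_mul (by positivity),
          ← ENNReal.ofReal_add (by positivity) (by positivity)]
        apply ENNReal.ofReal_le_ofReal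
        apply le_of_eq
        rw [Real.div_rpow hL0.le (by norm_num), Real.div_rpow hL0.le (by norm_num),
          Real.rpow_neg (by norm_num : (0:ℝ) ≤ 2), Real.rpow_neg (by norm_num : (0:ℝ) ≤ 2),
          Real.rpow_neg hL0.le, Real.rpow_neg hL0.le, Real.rpow_sub hL0, Real.rpow_sub hL0, Real.rpow_sub hL0, Real.rpow_sub hL0]
        field_simp

lemma exp_neg_le_rpow {p w : ℝ} (hp0 : 0 ≤ p) (hp : p ≤ 1) (hw : 0 < w) :
    Real.exp (-w) ≤ w ^ (-p) := by
  rw [Real.exp_neg, Real.rpow_neg hw.le]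
  apply inv_anti₀ (by positivity)
  have : w ^ p ≤ 1 + w := by
    rcases le_total w 1 with h | h
    · have := Real.rpow_le_one hw.le h hp0; linarith
    · have := Real.rpow_le_rpow_of_exponent_le h hp
      rw [Real.rpow_one] at this; linarith
  linarith [Real.add_one_le_exp w]

-- weighted integrals
lemma lint_expw {p l t : ℝ} (hp : p < 1) (hl : 0 < l) :
    ∫⁻ x in Ioo 0 t, ENNReal.ofReal (Real.exp (-(l * (t - x))) * (t - x) ^ (-p)) ≤
      ENNReal.ofReal (Real.Gamma (1 - p) * l ^ (p - 1)) := by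
  have h1 := Real.integral_rpow_mul_exp_neg_mul_Ioi (a := 1 - p) (r := l) (by linarith) hl
  have h2 : ∫⁻ w in Ioi (0:ℝ), ENNReal.ofReal (w ^ (1 - p - 1) * Real.exp (-(l * w))) =
      ENNReal.ofReal ((1 / l) ^ (1 - p) * Real.Gamma (1 - p)) := by
    rw [← h1, ofReal_integral_eq_lintegral_ofReal]
    · by_contra hni
      have h3 := integral_undef hni
      rw [h1] at h3
      have := Real.Gamma_pos_of_pos (s := 1 - p) (by linarith)
      have : 0 < (1 / l) ^ (1 - p) * Real.Gamma (1 - p) := by positivity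
      linarith
    · filter_upwards [self_mem_ae_restrict measurableSet_Ioi] with s hs
      have := Real.rpow_nonneg (le_of_lt hs) (1 - p - 1)
      positivity
  have h4 : ∫⁻ x in Ioo 0 t, ENNReal.ofReal (Real.exp (-(l * (t - x))) * (t - x) ^ (-p)) ≤ 
     ∫⁻ w in Ioi (0:ℝ), ENNReal.ofReal (w ^ (1 - p - 1) * Real.exp (-(l * w))) := by
    rw [← lintegral_indicator measurableSet_Ioo, ← lintegral_indicator measurableSet_Ioi,
      ← lintegral_sub_left_eq_self _ t]
    apply lintegral_mono
    intro w
    simp only [indicator]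
    by_cases h : t - w ∈ Ioo 0 t
    · have hw : w ∈ Ioi (0:ℝ) := by simp only [mem_Ioo, mem_Ioi] at *; linarith
      rw [if_pos h, if_pos hw]
      apply le_of_eq; congr 1
      rw [mul_comm]; congr 2 <;> ring
    · rw [if_neg h]; exact bot_le
  refine h4.trans (h2.le.trans (ENNReal.ofReal_le_ofReal (le_of_eq ?_)))
  rw [one_div, Real.inv_rpow hl.le, ← Real.rpow_neg hl.le, mul_comm]; congr 2; ring

lemma lint_expw2 {α r : ℝ} (hα : 0 < α) (hα' : α < 1) (hr0 : 0 ≤ r) (hr : r + α < 1) :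
    ∃ C : ℝ, 0 < C ∧ ∀ l t : ℝ, 0 < l → 0 < t →
    ∫⁻ x in Ioo 0 t, ENNReal.ofReal (Real.exp (-(l * (t - x))) * x ^ (-α) * (t - x) ^ (-r)) ≤
      ENNReal.ofReal (C * l ^ (r + α - 1)) := by
  obtain ⟨C, hC, h⟩ := lint_beta (p := 1 - α) (q := α) (by linarith) (by linarith) hα.le hα'
  refine ⟨C, hC, ?_⟩
  intro l t hl ht
  calc _ ≤ ∫⁻ x in Ioo 0 t, ENNReal.ofReal (l ^ (r + α - 1)) * ENNReal.ofReal ((t - x) ^ (-(1-α)) * (x - 0) ^ (-α)) := by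
        apply setLIntegral_mono' measurableSet_Ioo
        intro x hx
        have h1 : 0 < t - x := by linarith [hx.2]
        have hx0 : 0 < x := hx.1
        rw [← ENNReal.ofReal_mul (by positivity)]
        apply ENNReal.ofReal_le_ofReal
        have := exp_neg_le_rpow (p := 1 - α - r) (w := l * (t - x)) (by linarith) (by linarith) (by positivity)
        calc _ ≤ (l * (t-x)) ^ (-(1 - α - r)) * x ^ (-α) * (t-x) ^ (-r) := by gcongr
          _ = _ := by
            rw [Real.mul_rpow hl.le h1.le, sub_zero]
            have e : (t - x) ^ (-(1-α)) = (t-x) ^ (-(1 - α - r)) * (t-x) ^ (-r) := by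
              rw [← Real.rpow_add h1]; congr 1; ring
            rw [e]
            have : r + α - 1 = -(1 - α - r) := by ring
            rw [this]; ring
    _ ≤ _ := by
        rw [lintegral_const_mul _ (by fun_prop)]
        have := h 0 t ht
        calc _ ≤ ENNReal.ofReal (l ^ (r + α - 1)) * _ := mul_le_mul_right this _
          _ = _ := by
            rw [← ENNReal.ofReal_mul (by positivity)]
            congr 1
            have : 1 - (1 - α) - α = 0 := by ring
            rw [this]; simp; ring


lemma gron_aux {α r : ℝ} (hα : 0 < α) (hα' : α < 1) (hr0 : 0 ≤ r) (hr : r + α < 1) :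
    ∃ C : ℝ, 0 < C ∧ ∀ l t P Q : ℝ, 0 < l → 0 ≤ t → 0 ≤ P → 0 ≤ Q →
    ∫⁻ x in Ioo 0 t, (ENNReal.ofReal (P * Real.exp (l * x)) * ENNReal.ofReal (x ^ (-α))
        + ENNReal.ofReal (Q * Real.exp (l * x))) * ENNReal.ofReal ((t - x) ^ (-r)) ≤
      ENNReal.ofReal (C * Real.exp (l * t) * (P * l ^ (r + α - 1) + Q * l ^ (r - 1))) := by
  obtain ⟨C, hC, h⟩ := lint_expw2 hα hα' hr0 hr
  have hG := Real.Gamma_pos_of_pos (s := 1 - r) (by linarith)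
  refine ⟨C + Real.Gamma (1 - r), by positivity, ?_⟩
  intro l t P Q hl ht hP hQ
  rcases ht.eq_or_lt with rfl | ht
  · simp
  calc _ ≤ ∫⁻ x in Ioo 0 t, (ENNReal.ofReal (P * Real.exp (l * t)) *
          ENNReal.ofReal (Real.exp (-(l * (t - x))) * x ^ (-α) * (t - x) ^ (-r)) +
          ENNReal.ofReal (Q * Real.exp (l * t)) *
          ENNReal.ofReal (Real.exp (-(l * (t - x))) * (t - x) ^ (-r))) := by
        apply setLIntegral_mono' measurableSet_Ioo
        intro x hx
        have h1 : 0 < t - x := by linarith [hx.2]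
        have hx0 : 0 < x := hx.1
        rw [← ENNReal.ofReal_mul (by positivity), ← ENNReal.ofReal_add (by positivity) (by positivity),
          ← ENNReal.ofReal_mul (by positivity), ← ENNReal.ofReal_mul (by positivity),
          ← ENNReal.ofReal_mul (by positivity), ← ENNReal.ofReal_add (by positivity) (by positivity)]
        apply ENNReal.ofReal_le_ofReal
        apply le_of_eq
        have : Real.exp (l * x) = Real.exp (l * t) * Real.exp (-(l * (t - x))) := by
          rw [← Real.exp_add]; congr 1; ring
        rw [this]; ring
    _ ≤ ENNReal.ofReal (P * Real.exp (l * t)) * ENNReal.ofReal (C * l ^ (r + α - 1)) +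
        ENNReal.ofReal (Q * Real.exp (l * t)) * ENNReal.ofReal (Real.Gamma (1 - r) * l ^ (r - 1)) := by
        rw [lintegral_add_left (by fun_prop), lintegral_const_mul _ (by fun_prop),
          lintegral_const_mul _ (by fun_prop)]
        gcongr
        · exact h l t hl ht
        · exact lint_expw (by linarith) hl
    _ ≤ _ := by
        rw [← ENNReal.ofReal_mul (by positivity), ← ENNReal.ofReal_mul (by positivity),
          ← ENNReal.ofReal_add (by positivity) (by positivity)]
        apply ENNReal.ofReal_le_ofReal
        have a1 : 0 ≤ P * l ^ (r + α - 1) * Real.exp (l * t) * Real.Gamma (1 - r) := by positivity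
        have a2 : 0 ≤ Q * l ^ (r - 1) * Real.exp (l * t) * C := by positivity
        nlinarith

lemma gronwall_frac {α T : ℝ} (hα : 0 < α) (hα' : α < 1 / 2) (hT : 0 < T) :
    ∃ C : ℝ, 0 < C ∧ ∀ (Y Z : ℝ → ℝ≥0∞) (B : ℝ≥0∞) (K D : ℝ), 0 ≤ K → 1 ≤ D → B ≠ ⊤ →
      (∀ t ∈ Icc 0 T, Y t ≤ B) → (∀ t ∈ Icc 0 T, Z t ≤ B) →
      (∀ t ∈ Icc 0 T, Y t ≤ ENNReal.ofReal K + ENNReal.ofReal D *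
        ∫⁻ x in Ioo 0 t, (Y x * ENNReal.ofReal (x ^ (-α)) + Z x)) →
      (∀ t ∈ Icc 0 T, Z t ≤ ENNReal.ofReal K + ENNReal.ofReal D *
        ∫⁻ x in Ioo 0 t, (Y x * ENNReal.ofReal (x ^ (-α)) + Z x) * ENNReal.ofReal ((t - x) ^ (-α))) →
      ∀ t ∈ Icc 0 T, Y t ≤ ENNReal.ofReal (C * K * Real.exp (C * D ^ (1 / (1 - α)))) ∧
        Z t ≤ ENNReal.ofReal (C * K * Real.exp (C * D ^ (1 / (1 - α)))) := by
  obtain ⟨c1, hc1, h1⟩ := gron_aux (r := 0) hα (by linarith) le_rfl (by linarith)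
  obtain ⟨c2, hc2, h2⟩ := gron_aux (r := α) hα (by linarith) hα.le (by linarith)
  set c := 1 + c1 + c2 with hc
  have hcpos : 0 < c := by positivity
  have h1α : 0 < 1 - α := by linarith
  refine ⟨4 + (4 * c) ^ (1 / (1 - α)) * (T + 1), by positivity, ?_⟩
  intro Y Z B K D hK hD hB hYB hZB hY hZ
  have hD0 : 0 < D := by linarith
  set l := (4 * c * D) ^ (1 / (1 - α)) with hl
  have hb1 : 1 ≤ 4 * c * D := by nlinarith
  have hl1 : 1 ≤ l := Real.one_le_rpow hb1 (by positivity)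
  have hl0 : 0 < l := by linarith
  have hlp : l ^ (1 - α) = 4 * c * D := by
    rw [hl, ← Real.rpow_mul (by positivity), one_div, inv_mul_cancel₀ h1α.ne', Real.rpow_one]
  have hlm : c * D * l ^ (α - 1) = 1 / 4 := by
    have : α - 1 = -(1 - α) := by ring
    rw [this, Real.rpow_neg hl0.le, hlp]; field_simp
  have key : ∀ W : ℝ → ℝ≥0∞, (∀ t ∈ Icc 0 T, W t ≤ B) → ∃ P : ℝ, 0 ≤ P ∧
      (∀ t ∈ Icc 0 T, W t ≤ ENNReal.ofReal (P * Real.exp (l * t))) ∧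
      ∀ R : ℝ, 0 ≤ R → (∀ t ∈ Icc 0 T, W t ≤ ENNReal.ofReal (R * Real.exp (l * t))) → P ≤ R := by
    intro W hW
    set p := ⨆ (t : ℝ) (_ : t ∈ Icc 0 T), W t * ENNReal.ofReal (Real.exp (-(l * t))) with hp
    have hpB : p ≤ B := by
      apply iSup₂_le
      intro t ht
      have : ENNReal.ofReal (Real.exp (-(l * t))) ≤ 1 := by
        rw [ENNReal.ofReal_le_one, Real.exp_le_one_iff]
        have := mul_nonneg hl0.le ht.1; linarith
      calc _ ≤ B * 1 := mul_le_mul' (hW t ht) this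
        _ = B := mul_one B
    have hpt : p ≠ ⊤ := ne_top_of_le_ne_top hB hpB
    refine ⟨p.toReal, ENNReal.toReal_nonneg, ?_, ?_⟩
    · intro t ht
      rw [ENNReal.ofReal_mul ENNReal.toReal_nonneg, ENNReal.ofReal_toReal hpt]
      have : W t * ENNReal.ofReal (Real.exp (-(l * t))) ≤ p :=
        le_iSup₂ (f := fun (t : ℝ) (_ : t ∈ Icc 0 T) => W t * ENNReal.ofReal (Real.exp (-(l * t)))) t ht
      calc W t = W t * ENNReal.ofReal (Real.exp (-(l * t))) * ENNReal.ofReal (Real.exp (l * t)) := by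
            rw [mul_assoc, ← ENNReal.ofReal_mul (by positivity), ← Real.exp_add]; simp
        _ ≤ _ := by gcongr
    · intro R hR h
      apply ENNReal.toReal_le_of_le_ofReal hR
      apply iSup₂_le
      intro t ht
      calc _ ≤ ENNReal.ofReal (R * Real.exp (l * t)) * ENNReal.ofReal (Real.exp (-(l * t))) := by
            gcongr; exact h t ht
        _ = _ := by
            rw [← ENNReal.ofReal_mul (by positivity), mul_assoc, ← Real.exp_add]; simp
  obtain ⟨P, hP0, hP, hPm⟩ := key Y hYB
  obtain ⟨Q, hQ0, hQ, hQm⟩ := key Z hZB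
  have hexp : ∀ t ∈ Icc 0 T, 1 ≤ Real.exp (l * t) := fun t ht =>
    Real.one_le_exp (mul_nonneg hl0.le ht.1)
  have bP : P ≤ K + D * (c * (P * l ^ (α - 1) + Q * l ^ (-1 : ℝ))) := by
    apply hPm _ (by positivity)
    intro t ht
    have e1 : ∫⁻ x in Ioo 0 t, (Y x * ENNReal.ofReal (x ^ (-α)) + Z x) ≤
        ENNReal.ofReal (c1 * Real.exp (l * t) * (P * l ^ (0 + α - 1) + Q * l ^ (0 - 1 : ℝ))) := by
      refine le_trans ?_ (h1 l t P Q hl0 ht.1 hP0 hQ0)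
      apply setLIntegral_mono' measurableSet_Ioo
      intro x hx
      have hxT : x ∈ Icc 0 T := ⟨hx.1.le, hx.2.le.trans ht.2⟩
      simp only [neg_zero, Real.rpow_zero, ENNReal.ofReal_one, mul_one]
      gcongr
      · exact hP x hxT
      · exact hQ x hxT
    refine (hY t ht).trans ?_
    refine (add_le_add le_rfl (mul_le_mul' le_rfl e1)).trans ?_
    ·   rw [← ENNReal.ofReal_mul hD0.le, ← ENNReal.ofReal_add hK (by positivity)]
        apply ENNReal.ofReal_le_ofReal
        rw [zero_add, zero_sub]
        have i1 : K ≤ K * Real.exp (l * t) := le_mul_of_one_le_right hK (hexp t ht)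
        have i2 : D * (c1 * Real.exp (l * t) * (P * l ^ (α - 1) + Q * l ^ (-1 : ℝ))) ≤
          D * (c * Real.exp (l * t) * (P * l ^ (α - 1) + Q * l ^ (-1 : ℝ))) := by
          gcongr; linarith
        linarith
  have bQ : Q ≤ K + D * (c * (P * l ^ (α + α - 1) + Q * l ^ (α - 1))) := by
    apply hQm _ (by positivity)
    intro t ht
    have e1 : ∫⁻ x in Ioo 0 t, (Y x * ENNReal.ofReal (x ^ (-α)) + Z x) * ENNReal.ofReal ((t - x) ^ (-α)) ≤
        ENNReal.ofReal (c2 * Real.exp (l * t) * (P * l ^ (α + α - 1) + Q * l ^ (α - 1))) := by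
      refine le_trans ?_ (h2 l t P Q hl0 ht.1 hP0 hQ0)
      apply setLIntegral_mono' measurableSet_Ioo
      intro x hx
      have hxT : x ∈ Icc 0 T := ⟨hx.1.le, hx.2.le.trans ht.2⟩
      gcongr
      · exact hP x hxT
      · exact hQ x hxT
    refine (hZ t ht).trans ?_
    refine (add_le_add le_rfl (mul_le_mul' le_rfl e1)).trans ?_
    ·   rw [← ENNReal.ofReal_mul hD0.le, ← ENNReal.ofReal_add hK (by positivity)]
        apply ENNReal.ofReal_le_ofReal
        have i1 : K ≤ K * Real.exp (l * t) := le_mul_of_one_le_right hK (hexp t ht)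
        have i2 : D * (c2 * Real.exp (l * t) * (P * l ^ (α + α - 1) + Q * l ^ (α - 1))) ≤
          D * (c * Real.exp (l * t) * (P * l ^ (α + α - 1) + Q * l ^ (α - 1))) := by
          gcongr; linarith
        linarith
  -- combine
  set m := l ^ (-α) with hm
  have hm0 : 0 < m := by positivity
  have hm1 : m ≤ 1 := Real.rpow_le_one_of_one_le_of_nonpos hl1 (by linarith)
  have em : l ^ (-1 : ℝ) = l ^ (α - 1) * m := by
    rw [hm, ← Real.rpow_add hl0]; congr 1; ring
  have em2 : m * l ^ (α + α - 1) = l ^ (α - 1) := by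
    rw [hm, ← Real.rpow_add hl0]; congr 1; ring
  have bP' : P ≤ K + 1 / 4 * (P + m * Q) := by
    rw [em] at bP
    calc P ≤ _ := bP
      _ = K + (c * D * l ^ (α - 1)) * (P + m * Q) := by ring
      _ = _ := by rw [hlm]
  have bQ' : m * Q ≤ K + 1 / 4 * (P + m * Q) := by
    calc m * Q ≤ m * (K + D * (c * (P * l ^ (α + α - 1) + Q * l ^ (α - 1)))) := by gcongr
      _ = m * K + D * c * P * (m * l ^ (α + α - 1)) + D * c * l ^ (α - 1) * m * Q := by ring
      _ = m * K + (c * D * l ^ (α - 1)) * (P + m * Q) := by rw [em2]; ring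
      _ = m * K + 1 / 4 * (P + m * Q) := by rw [hlm]
      _ ≤ 1 * K + 1 / 4 * (P + m * Q) := by gcongr
      _ = _ := by ring
  have hmQ : 0 ≤ m * Q := by positivity
  have fP : P ≤ 4 * K := by linarith
  have fQ : m * Q ≤ 4 * K := by linarith
  have fQ' : Q ≤ 4 * K * l ^ α := by
    have : Q = (m * Q) * l ^ α := by
      rw [hm, Real.rpow_neg hl0.le]; field_simp
    rw [this]; gcongr
  have hle : l ^ α ≤ Real.exp l := by
    calc l ^ α ≤ l ^ (1:ℝ) := Real.rpow_le_rpow_of_exponent_le hl1 (by linarith)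
      _ = l := Real.rpow_one l
      _ ≤ _ := by linarith [Real.add_one_le_exp l]
  have hle1 : 1 ≤ Real.exp l := Real.one_le_exp hl0.le
  have hlC : l * (T + 1) ≤ (4 + (4 * c) ^ (1 / (1 - α)) * (T + 1)) * D ^ (1 / (1 - α)) := by
    rw [hl, Real.mul_rpow (by positivity) hD0.le]
    have : 0 ≤ D ^ (1 / (1 - α)) := by positivity
    nlinarith
  have fin : ∀ t ∈ Icc 0 T, 4 * K * Real.exp l * Real.exp (l * t) ≤
     (4 + (4 * c) ^ (1 / (1 - α)) * (T + 1)) * K * Real.exp ((4 + (4 * c) ^ (1 / (1 - α)) * (T + 1)) * D ^ (1 / (1 - α))) := by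
    intro t ht
    rw [mul_assoc (4 * K), ← Real.exp_add]
    gcongr
    · have : 0 ≤ (4 * c) ^ (1 / (1 - α)) * (T + 1) := by positivity
      linarith
    · refine le_trans ?_ hlC
      have := mul_le_mul_of_nonneg_left ht.2 hl0.le
      linarith
  intro t ht
  refine ⟨(hP t ht).trans (ENNReal.ofReal_le_ofReal (le_trans ?_ (fin t ht))),
    (hQ t ht).trans (ENNReal.ofReal_le_ofReal (le_trans ?_ (fin t ht)))⟩
  · gcongr
    nlinarith
  · gcongr
    exact fQ'.trans (by gcongr)





lemma zn_lt {α T : ℝ} {g : ℝ → ℝ} (h : zeroNorm α 0 T g < ⊤) {u v : ℝ} (hu : 0 ≤ u) (huv : u < v)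
    (hv : v < T) : |g v - g u| ≤ (zeroNorm α 0 T g).toReal * (v - u) ^ (1 - α) ∧
      ∫ z in Ioo u v, |g u - g z| / (z - u) ^ (2 - α) ≤ (zeroNorm α 0 T g).toReal := by
  have hp : 0 < (v - u) ^ (1 - α) := Real.rpow_pos_of_pos (by linarith) _
  have h1 : ENNReal.ofReal (|g v - g u| / (v - u) ^ (1 - α)
      + ∫ z in Ioo u v, |g u - g z| / (z - u) ^ (2 - α)) ≤ zeroNorm α 0 T g := by
    unfold zeroNorm
    exact le_iSup_of_le u (le_iSup_of_le v (le_iSup_of_le hu (le_iSup_of_le huv (le_iSup_of_le hv le_rfl))))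
  rw [ENNReal.ofReal_le_iff_le_toReal h.ne] at h1
  have h2 : 0 ≤ |g v - g u| / (v - u) ^ (1 - α) := by positivity
  have h3 : 0 ≤ ∫ z in Ioo u v, |g u - g z| / (z - u) ^ (2 - α) := by
    apply setIntegral_nonneg measurableSet_Ioo
    intro z hz
    have := Real.rpow_nonneg (by linarith [hz.1] : 0 ≤ z - u) (2 - α)
    positivity
  refine ⟨?_, by linarith⟩
  rw [← div_le_iff₀ hp]; linarith

lemma zn_hold {α T : ℝ} {g : ℝ → ℝ} (hα : α < 1) (hg : ContinuousOn g (Icc 0 T)) (h : zeroNorm α 0 T g < ⊤) {u v : ℝ} (hu : 0 ≤ u) (huv : u < v)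
    (hv : v ≤ T) : |g v - g u| ≤ (zeroNorm α 0 T g).toReal * (v - u) ^ (1 - α) := by
  rcases hv.lt_or_eq with hv | rfl
  · exact (zn_lt h hu huv hv).1
  have hne : (nhdsWithin v (Ioo u v)).NeBot := by
    rw [← mem_closure_iff_nhdsWithin_neBot, closure_Ioo huv.ne]; exact ⟨huv.le, le_rfl⟩
  have hc : Filter.Tendsto g (nhdsWithin v (Ioo u v)) (nhds (g v)) :=
    (hg v ⟨by linarith, le_rfl⟩).mono_left (nhdsWithin_mono _ (fun x hx => ⟨by linarith [hx.1], hx.2.le⟩))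
  have hr : Filter.Tendsto (fun x : ℝ => (zeroNorm α 0 v g).toReal * (x - u) ^ (1 - α)) (nhdsWithin v (Ioo u v))
      (nhds ((zeroNorm α 0 v g).toReal * (v - u) ^ (1 - α))) := by
    apply Filter.Tendsto.mono_left _ nhdsWithin_le_nhds
    apply ContinuousAt.tendsto (f := fun x : ℝ => (zeroNorm α 0 v g).toReal * (x - u) ^ (1 - α))
    have : ContinuousAt (fun x : ℝ => (x - u) ^ (1 - α)) v :=
      ContinuousAt.rpow_const (by fun_prop) (Or.inr (by linarith))
    exact continuousAt_const.mul this
  refine le_of_tendsto_of_tendsto ((hc.sub_const (g u)).abs) hr ?_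
  filter_upwards [self_mem_nhdsWithin] with x hx
  exact (zn_lt h hu hx.1 hx.2).1

lemma zn_int {α T : ℝ} {g : ℝ → ℝ} (h : zeroNorm α 0 T g < ⊤) {u v : ℝ} (hu : 0 ≤ u) (huv : u < v)
    (hv : v ≤ T) : |∫ z in Ioo u v, (g u - g z) / (z - u) ^ (2 - α)| ≤ (zeroNorm α 0 T g).toReal := by
  have habs : ∀ w, |∫ z in Ioo u w, (g u - g z) / (z - u) ^ (2 - α)| ≤ ∫ z in Ioo u w, |g u - g z| / (z - u) ^ (2 - α) := by
    intro w
    refine abs_integral_le_integral_abs.trans (le_of_eq ?_)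
    apply setIntegral_congr_fun measurableSet_Ioo
    intro z hz
    have := Real.rpow_nonneg (by linarith [hz.1] : 0 ≤ z - u) (2 - α)
    simp only [abs_div, abs_of_nonneg this]
  rcases hv.lt_or_eq with hv | rfl
  · exact (habs v).trans (zn_lt h hu huv hv).2
  by_cases hi : IntegrableOn (fun z => (g u - g z) / (z - u) ^ (2 - α)) (Ioo u v)
  swap
  · rw [integral_undef hi]; simp
  have hne : (nhdsWithin v (Ioo u v)).NeBot := by
    rw [← mem_closure_iff_nhdsWithin_neBot, closure_Ioo huv.ne]; exact ⟨huv.le, le_rfl⟩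
  have hi' : IntegrableOn (fun z => (g u - g z) / (z - u) ^ (2 - α)) (uIcc u v) := by
    rw [uIcc_of_le huv.le, integrableOn_Icc_iff_integrableOn_Ioo]; exact hi
  have hco := intervalIntegral.continuousOn_primitive_interval hi'
  have hc : Filter.Tendsto (fun x => ∫ z in u..x, (g u - g z) / (z - u) ^ (2 - α)) (nhdsWithin v (Ioo u v))
      (nhds (∫ z in u..v, (g u - g z) / (z - u) ^ (2 - α))) :=
    (hco v right_mem_uIcc).mono_left (nhdsWithin_mono _ (fun x hx => by
      rw [uIcc_of_le huv.le]; exact ⟨hx.1.le, hx.2.le⟩))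
  rw [← integral_Ioc_eq_integral_Ioo, ← intervalIntegral.integral_of_le huv.le]
  refine le_of_tendsto hc.abs ?_
  filter_upwards [self_mem_nhdsWithin] with x hx
  rw [intervalIntegral.integral_of_le hx.1.le, integral_Ioc_eq_integral_Ioo]
  exact (habs x).trans (zn_lt h hu hx.1 hx.2).2

lemma fracDerivM_bound {α T : ℝ} {g : ℝ → ℝ} (hα0 : 0 < α) (hα : α < 1) (hg : ContinuousOn g (Icc 0 T))
    (h : zeroNorm α 0 T g < ⊤) {x b : ℝ} (hx : 0 ≤ x) (hxb : x < b) (hb : b ≤ T) :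
    |fracDerivM α b g x| ≤ 2 / Real.Gamma α * (zeroNorm α 0 T g).toReal := by
  have hG := Real.Gamma_pos_of_pos hα0
  have hp : 0 < (b - x) ^ (1 - α) := Real.rpow_pos_of_pos (by linarith) _
  have h1 := zn_hold hα hg h hx hxb hb
  have h2 := zn_int h hx hxb hb
  set Λ := (zeroNorm α 0 T g).toReal with hΛ
  have hΛ0 : 0 ≤ Λ := ENNReal.toReal_nonneg
  unfold fracDerivM
  set I := ∫ z in Ioo x b, (g x - g z) / (z - x) ^ (2 - α)
  have h3 : |(g x - g b) / (b - x) ^ (1 - α)| ≤ Λ := by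
    rw [abs_div, abs_of_pos hp, div_le_iff₀ hp, abs_sub_comm]; exact h1
  have h4 : |(1 - α) * I| ≤ Λ := by
    rw [abs_mul, abs_of_pos (by linarith : 0 < 1 - α)]
    nlinarith [abs_nonneg I]
  rw [abs_mul, abs_of_pos (by positivity : 0 < 1 / Real.Gamma α)]
  calc _ ≤ 1 / Real.Gamma α * (Λ + Λ) := by
        gcongr
        exact (abs_add_le _ _).trans (add_le_add h3 h4)
    _ = _ := by ring

lemma log_aux {α r k : ℝ} (hα0 : 0 < α) (hα : α < 1) (hr : 0 < r) (hk : 0 < k) :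
    Real.log ((r + k) / r) ≤ (k / r) ^ (1 - α) / (1 - α) := by
  have h1 : 0 < 1 - α := by linarith
  have e : (r + k) / r = 1 + k / r := by field_simp
  rw [e]
  set y := k / r with hy
  have hy0 : 0 < y := by positivity
  have hsub : (1 + y) ^ (1 - α) ≤ 1 + y ^ (1 - α) := by
    have := Real.rpow_add_le_add_rpow (p := 1 - α) (a := 1) (b := y) (by norm_num) hy0.le h1.le (by linarith)
    simpa using this
  have h2 : Real.log ((1 + y) ^ (1 - α)) ≤ y ^ (1 - α) := by
    have := Real.log_le_sub_one_of_pos (by positivity : 0 < (1 + y) ^ (1 - α))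
    linarith
  rw [Real.log_rpow (by positivity)] at h2
  rw [le_div_iff₀ h1]; linarith


lemma int_diff {α T : ℝ} {g : ℝ → ℝ} (hα : α < 1) (hg : ContinuousOn g (Icc 0 T))
    (h : zeroNorm α 0 T g < ⊤) {x s t : ℝ} (hx : 0 ≤ x) (hxs : x < s) (hst : s < t) (ht : t ≤ T) :
    |(∫ z in Ioo x t, (g x - g z) / (z - x) ^ (2 - α)) - ∫ z in Ioo x s, (g x - g z) / (z - x) ^ (2 - α)|
      ≤ (zeroNorm α 0 T g).toReal * Real.log ((t - x) / (s - x)) := by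
  set Λ := (zeroNorm α 0 T g).toReal with hΛ
  have hΛ0 : 0 ≤ Λ := ENNReal.toReal_nonneg
  have hlog : 0 ≤ Real.log ((t - x) / (s - x)) := by
    apply Real.log_nonneg
    rw [le_div_iff₀ (by linarith)]; linarith
  have hi2 : IntervalIntegrable (fun z => (g x - g z) / (z - x) ^ (2 - α)) volume s t := by
    apply ContinuousOn.intervalIntegrable
    rw [uIcc_of_le hst.le]
    apply ContinuousOn.div
    · exact continuousOn_const.sub (hg.mono (Icc_subset_Icc (by linarith) ht))
    · apply ContinuousOn.rpow_const (by fun_prop)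
      intro z hz; left; have := hz.1; intro h0; linarith
    · intro z hz; exact (Real.rpow_pos_of_pos (by linarith [hz.1]) _).ne'
  simp only [← integral_Ioc_eq_integral_Ioo]
  rw [← intervalIntegral.integral_of_le (by linarith), ← intervalIntegral.integral_of_le hxs.le]
  by_cases hi : IntervalIntegrable (fun z => (g x - g z) / (z - x) ^ (2 - α)) volume x s
  · rw [intervalIntegral.integral_interval_sub_left (hi.trans hi2) hi]
    have hb : ∀ᵐ z, z ∈ Ioc s t → ‖(g x - g z) / (z - x) ^ (2 - α)‖ ≤ Λ * (z - x)⁻¹ := by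
      refine Filter.Eventually.of_forall fun z hz => ?_
      have hzx : 0 < z - x := by linarith [hz.1]
      have h1 := zn_hold hα hg h hx (by linarith) (hz.2.trans ht)
      rw [Real.norm_eq_abs, abs_div, abs_of_pos (Real.rpow_pos_of_pos hzx _), abs_sub_comm,
        div_le_iff₀ (Real.rpow_pos_of_pos hzx _)]
      calc _ ≤ _ := h1
        _ = _ := by
          have : (2 - α) = (1 - α) + 1 := by ring
          rw [this, Real.rpow_add hzx, Real.rpow_one]; field_simp; rfl
    have hii : IntervalIntegrable (fun z => Λ * (z - x)⁻¹) volume s t := by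
      apply ContinuousOn.intervalIntegrable
      rw [uIcc_of_le hst.le]
      apply continuousOn_const.mul
      apply ContinuousOn.inv₀ (by fun_prop)
      intro z hz; have := hz.1; intro h0; linarith
    have := intervalIntegral.norm_integral_le_of_norm_le hst.le hb hii
    rw [Real.norm_eq_abs] at this
    refine this.trans (le_of_eq ?_)
    rw [intervalIntegral.integral_const_mul, intervalIntegral.integral_comp_sub_right (fun z => z⁻¹) x,
      integral_inv]
    rw [uIcc_of_le (by linarith)]; intro h0; linarith [h0.1]
  · have hi' : ¬ IntervalIntegrable (fun z => (g x - g z) / (z - x) ^ (2 - α)) volume x t := by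
      intro h'
      exact hi (h'.trans hi2.symm)
    rw [intervalIntegral.integral_undef hi, intervalIntegral.integral_undef hi']
    simp; positivity

lemma fracDerivM_diff {α T : ℝ} {g : ℝ → ℝ} (hα0 : 0 < α) (hα : α < 1) (hg : ContinuousOn g (Icc 0 T))
    (h : zeroNorm α 0 T g < ⊤) {x s t : ℝ} (hx : 0 ≤ x) (hxs : x < s) (hst : s < t) (ht : t ≤ T) :
    |fracDerivM α t g x - fracDerivM α s g x| ≤
      3 / Real.Gamma α * (zeroNorm α 0 T g).toReal * ((t - s) ^ (1 - α) * (s - x) ^ (-(1 - α))) := by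
  have hG := Real.Gamma_pos_of_pos hα0
  have h1α : 0 < 1 - α := by linarith
  have hI := int_diff hα hg h hx hxs hst ht
  have hg1 := zn_hold hα hg h hx hxs (hst.le.trans ht)
  have hg2 := zn_hold hα hg h (hx.trans hxs.le) hst ht
  have hlog := log_aux hα0 hα (sub_pos.2 hxs) (sub_pos.2 hst)
  have e0 : s - x + (t - s) = t - x := by ring
  rw [e0] at hlog
  have hsubadd := Real.rpow_add_le_add_rpow (p := 1 - α) (a := s - x) (b := t - s)
    (by linarith) (by linarith) h1α.le (by linarith)
  rw [e0] at hsubadd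
  have hmono : (s - x) ^ (1 - α) ≤ (t - x) ^ (1 - α) :=
    Real.rpow_le_rpow (by linarith) (by linarith) h1α.le
  rw [Real.div_rpow (by linarith) (by linarith)] at hlog
  rw [Real.rpow_neg (by linarith)]
  set Λ := (zeroNorm α 0 T g).toReal with hΛ
  have hΛ0 : 0 ≤ Λ := ENNReal.toReal_nonneg
  unfold fracDerivM
  set It := ∫ z in Ioo x t, (g x - g z) / (z - x) ^ (2 - α)
  set Is := ∫ z in Ioo x s, (g x - g z) / (z - x) ^ (2 - α)
  have hA : 0 < (s - x) ^ (1 - α) := Real.rpow_pos_of_pos (by linarith) _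
  have hB : 0 < (t - x) ^ (1 - α) := Real.rpow_pos_of_pos (by linarith) _
  have hH : 0 < (t - s) ^ (1 - α) := Real.rpow_pos_of_pos (by linarith) _
  set A := (s - x) ^ (1 - α)
  set B := (t - x) ^ (1 - α)
  set H := (t - s) ^ (1 - α)
  have hHB : H / B ≤ H / A := by gcongr
  have p1 : |(g s - g t) / B| ≤ Λ * (H / A) := by
    rw [abs_div, abs_of_pos hB, abs_sub_comm]
    calc _ ≤ Λ * H / B := by gcongr
      _ = Λ * (H / B) := by ring
      _ ≤ _ := by gcongr
  have p2 : |(g x - g s) * (1 / B - 1 / A)| ≤ Λ * (H / A) := by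
    rw [abs_mul, abs_sub_comm (g x), abs_sub_comm (1 / B)]
    have : 1 / B ≤ 1 / A := by gcongr
    rw [abs_of_nonneg (by linarith : 0 ≤ 1 / A - 1 / B)]
    calc _ ≤ Λ * A * (1 / A - 1 / B) := by gcongr
      _ = Λ * ((B - A) / B) := by field_simp
      _ ≤ Λ * (H / B) := by gcongr; linarith
      _ ≤ _ := by gcongr
  have p3 : |(1 - α) * (It - Is)| ≤ Λ * (H / A) := by
    rw [abs_mul, abs_of_pos h1α]
    calc _ ≤ (1 - α) * (Λ * (H / A / (1 - α))) := by
          gcongr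
          exact hI.trans (by gcongr)
      _ = _ := by field_simp
  have e : 1 / Real.Gamma α * ((g x - g t) / B + (1 - α) * It) - 1 / Real.Gamma α * ((g x - g s) / A + (1 - α) * Is)
      = 1 / Real.Gamma α * ((g s - g t) / B + (g x - g s) * (1 / B - 1 / A) + (1 - α) * (It - Is)) := by
    ring
  rw [e, abs_mul, abs_of_pos (by positivity : 0 < 1 / Real.Gamma α)]
  calc _ ≤ 1 / Real.Gamma α * (Λ * (H / A) + Λ * (H / A) + Λ * (H / A)) := by
        gcongr
        exact (abs_add_le _ _).trans (add_le_add ((abs_add_le _ _).trans (add_le_add p1 p2)) p3)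
    _ = _ := by ring

lemma fracDerivP_meas {α : ℝ} {f : ℝ → ℝ} (hf : Measurable f) : Measurable (fracDerivP α 0 f) := by
  unfold fracDerivP
  have : Measurable fun x => ∫ u in Ioo 0 x, (f x - f u) / (x - u) ^ (1 + α) := by
    have e : (fun x => ∫ u in Ioo 0 x, (f x - f u) / (x - u) ^ (1 + α)) =
        fun x => ∫ u, ({p : ℝ × ℝ | 0 < p.2 ∧ p.2 < p.1}.indicator (fun p => (f p.1 - f p.2) / (p.1 - p.2) ^ (1 + α))) (x, u) := by
      funext x
      rw [← integral_indicator measurableSet_Ioo]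
      congr 1
    rw [e]
    have hm : Measurable ({p : ℝ × ℝ | 0 < p.2 ∧ p.2 < p.1}.indicator (fun p => (f p.1 - f p.2) / (p.1 - p.2) ^ (1 + α))) := by
      apply Measurable.indicator
      · fun_prop
      · exact (measurableSet_lt measurable_const measurable_snd).inter (measurableSet_lt measurable_snd measurable_fst)
    exact (hm.stronglyMeasurable.integral_prod_right').measurable
  fun_prop

lemma fracDerivM_meas {α b : ℝ} {f : ℝ → ℝ} (hf : Measurable f) : Measurable (fracDerivM α b f) := by
  unfold fracDerivM
  have : Measurable fun x => ∫ u in Ioo x b, (f x - f u) / (u - x) ^ (2 - α) := by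
    have e : (fun x => ∫ u in Ioo x b, (f x - f u) / (u - x) ^ (2 - α)) =
        fun x => ∫ u, ({p : ℝ × ℝ | p.1 < p.2 ∧ p.2 < b}.indicator (fun p => (f p.1 - f p.2) / (p.2 - p.1) ^ (2 - α))) (x, u) := by
      funext x
      rw [← integral_indicator measurableSet_Ioo]
      congr 1
    rw [e]
    have hm : Measurable ({p : ℝ × ℝ | p.1 < p.2 ∧ p.2 < b}.indicator (fun p => (f p.1 - f p.2) / (p.2 - p.1) ^ (2 - α))) := by
      apply Measurable.indicator
      · fun_prop
      · exact (measurableSet_lt measurable_fst measurable_snd).inter (measurableSet_lt measurable_snd measurable_const)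
    exact (hm.stronglyMeasurable.integral_prod_right').measurable
  fun_prop


lemma tri_swap {t : ℝ} {h : ℝ → ℝ → ℝ≥0∞} (hm : Measurable (Function.uncurry h)) :
    ∫⁻ s in Ioo 0 t, ∫⁻ x in Ioo s t, h s x = ∫⁻ x in Ioo 0 t, ∫⁻ s in Ioo 0 x, h s x := by
  have hS : MeasurableSet {p : ℝ × ℝ | 0 < p.1 ∧ p.1 < p.2 ∧ p.2 < t} :=
    (measurableSet_lt measurable_const measurable_fst).inter
      ((measurableSet_lt measurable_fst measurable_snd).inter (measurableSet_lt measurable_snd measurable_const))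
  set H := {p : ℝ × ℝ | 0 < p.1 ∧ p.1 < p.2 ∧ p.2 < t}.indicator (Function.uncurry h) with hH
  have hHm : Measurable H := hm.indicator hS
  have e1 : ∫⁻ s in Ioo 0 t, ∫⁻ x in Ioo s t, h s x = ∫⁻ s, ∫⁻ x, H (s, x) := by
    rw [← lintegral_indicator measurableSet_Ioo]
    apply lintegral_congr
    intro s
    by_cases hs : s ∈ Ioo 0 t
    · rw [indicator_of_mem hs, ← lintegral_indicator measurableSet_Ioo]
      apply lintegral_congr
      intro x
      simp only [hH, indicator, mem_Ioo, mem_ofPred_eq, Function.uncurry]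
      simp only [mem_Ioo] at hs
      congr 1
      simp [hs.1]
    · rw [indicator_of_notMem hs]
      symm
      rw [lintegral_eq_zero_iff' (by fun_prop)]
      refine Filter.Eventually.of_forall fun x => ?_
      simp only [hH, indicator, mem_ofPred_eq, Pi.zero_apply]
      rw [if_neg]
      rintro ⟨h1, h2, h3⟩
      exact hs ⟨h1, h2.trans h3⟩
  have e2 : ∫⁻ x in Ioo 0 t, ∫⁻ s in Ioo 0 x, h s x = ∫⁻ x, ∫⁻ s, H (s, x) := by
    rw [← lintegral_indicator measurableSet_Ioo]
    apply lintegral_congr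
    intro x
    by_cases hx : x ∈ Ioo 0 t
    · rw [indicator_of_mem hx, ← lintegral_indicator measurableSet_Ioo]
      apply lintegral_congr
      intro s
      simp only [hH, indicator, mem_Ioo, mem_ofPred_eq, Function.uncurry]
      simp only [mem_Ioo] at hx
      congr 1
      simp [hx.2]
    · rw [indicator_of_notMem hx]
      symm
      rw [lintegral_eq_zero_iff' (by fun_prop)]
      refine Filter.Eventually.of_forall fun s => ?_
      simp only [hH, indicator, mem_ofPred_eq, Pi.zero_apply]
      rw [if_neg]
      rintro ⟨h1, h2, h3⟩
      exact hx ⟨h1.trans h2, h3⟩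
  rw [e1, e2]
  exact lintegral_lintegral_swap (f := fun s x => H (s, x)) hHm.aemeasurable

lemma kern {α : ℝ} (hα : 0 < α) (hα' : α < 1 / 2) :
    ∃ C : ℝ, 0 < C ∧ ∀ (Φ : ℝ → ℝ≥0∞), Measurable Φ → ∀ t : ℝ,
      ∫⁻ s in Ioo 0 t, ENNReal.ofReal ((t - s) ^ (-1 - α)) * ((∫⁻ x in Ioo s t, Φ x) +
        ENNReal.ofReal ((t - s) ^ (1 - α)) * ∫⁻ x in Ioo 0 s, Φ x * ENNReal.ofReal ((s - x) ^ (-(1 - α))))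
      ≤ ENNReal.ofReal C * ∫⁻ x in Ioo 0 t, Φ x * ENNReal.ofReal ((t - x) ^ (-α)) := by
  obtain ⟨B, hB, hb⟩ := lint_beta (p := 2 * α) (q := 1 - α) (by linarith) (by linarith) (by linarith) (by linarith)
  refine ⟨1 / α + B, by positivity, ?_⟩
  intro Φ hΦ t
  have j1 : ∫⁻ s in Ioo 0 t, ∫⁻ x in Ioo s t, ENNReal.ofReal ((t - s) ^ (-1 - α)) * Φ x ≤
      ENNReal.ofReal (1 / α) * ∫⁻ x in Ioo 0 t, Φ x * ENNReal.ofReal ((t - x) ^ (-α)) := by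
    rw [tri_swap (by fun_prop), ← lintegral_const_mul' _ _ ENNReal.ofReal_ne_top]
    apply setLIntegral_mono' measurableSet_Ioo
    intro x hx
    rw [lintegral_mul_const _ (by fun_prop)]
    calc _ ≤ ENNReal.ofReal ((t - x) ^ (-α) / α) * Φ x := by
          gcongr; exact lint_far hα hx.1.le hx.2
      _ = _ := by
          rw [div_eq_mul_one_div, mul_comm _ (1 / α), ENNReal.ofReal_mul (by positivity)]; ring
  have j2 : ∫⁻ s in Ioo 0 t, ∫⁻ x in Ioo 0 s, Φ x * ENNReal.ofReal ((t - s) ^ (-(2 * α)) * (s - x) ^ (-(1 - α))) ≤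
      ENNReal.ofReal B * ∫⁻ x in Ioo 0 t, Φ x * ENNReal.ofReal ((t - x) ^ (-α)) := by
    have := tri_swap (t := t) (h := fun x s => Φ x * ENNReal.ofReal ((t - s) ^ (-(2 * α)) * (s - x) ^ (-(1 - α)))) (by fun_prop)
    rw [← this, ← lintegral_const_mul' _ _ ENNReal.ofReal_ne_top]
    apply setLIntegral_mono' measurableSet_Ioo
    intro x hx
    rw [lintegral_const_mul _ (by fun_prop)]
    calc _ ≤ Φ x * ENNReal.ofReal (B * (t - x) ^ (1 - 2 * α - (1 - α))) := by
          gcongr; exact hb x t hx.2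
      _ = _ := by
          have : 1 - 2 * α - (1 - α) = -α := by ring
          rw [this, ENNReal.ofReal_mul (by positivity)]; ring
  calc _ ≤ ∫⁻ s in Ioo 0 t, ((∫⁻ x in Ioo s t, ENNReal.ofReal ((t - s) ^ (-1 - α)) * Φ x) +
        ∫⁻ x in Ioo 0 s, Φ x * ENNReal.ofReal ((t - s) ^ (-(2 * α)) * (s - x) ^ (-(1 - α)))) := by
        apply setLIntegral_mono' measurableSet_Ioo
        intro s hs
        have hts : 0 < t - s := sub_pos.2 hs.2
        rw [mul_add, lintegral_const_mul _ hΦ]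
        gcongr
        rw [← mul_assoc, ← ENNReal.ofReal_mul (by positivity), ← Real.rpow_add hts,
          ← lintegral_const_mul _ (by fun_prop)]
        apply lintegral_mono
        intro x
        apply le_of_eq
        have : -1 - α + (1 - α) = -(2 * α) := by ring
        simp only [this]
        rw [ENNReal.ofReal_mul (by positivity)]; ring
    _ = _ := by
        apply lintegral_add_left
        have : Measurable ({p : ℝ × ℝ | p.1 < p.2 ∧ p.2 < t}.indicator
            (fun p : ℝ × ℝ => ENNReal.ofReal ((t - p.1) ^ (-1 - α)) * Φ p.2)) := by
          apply Measurable.indicator (by fun_prop)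
          exact (measurableSet_lt measurable_fst measurable_snd).inter (measurableSet_lt measurable_snd measurable_const)
        have h2 := this.lintegral_prod_right' (ν := (volume : Measure ℝ))
        simp_rw [← lintegral_indicator measurableSet_Ioo]
        exact h2
    _ ≤ _ := by
        rw [ENNReal.ofReal_add (by positivity) hB.le, add_mul]
        exact add_le_add j1 j2

lemma fracDerivP_bound {α : ℝ} (hα : 0 < α) (hα' : α < 1) (f : ℝ → ℝ) {x : ℝ} (hx : 0 < x) :
    ENNReal.ofReal |fracDerivP α 0 f x| ≤ ENNReal.ofReal (1 / Real.Gamma (1 - α)) *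
      (ENNReal.ofReal (|f x| * x ^ (-α)) + pathNorm α f x) := by
  have hG := Real.Gamma_pos_of_pos (s := 1 - α) (by linarith)
  unfold fracDerivP
  rw [abs_mul, abs_of_pos (by positivity), ENNReal.ofReal_mul (by positivity)]
  gcongr
  have h1 : ENNReal.ofReal |∫ u in Ioo 0 x, (f x - f u) / (x - u) ^ (1 + α)| ≤ pathNorm α f x := by
    rw [← Real.enorm_eq_ofReal_abs]
    refine (enorm_integral_le_lintegral_enorm _).trans ?_
    unfold pathNorm
    apply setLIntegral_mono' measurableSet_Ioo
    intro u hu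
    have hxu : 0 < x - u := sub_pos.2 hu.2
    rw [Real.enorm_eq_ofReal_abs, abs_div, abs_of_pos (by positivity : 0 < (x - u) ^ (1 + α))]
    apply ENNReal.ofReal_le_ofReal
    have : -1 - α = -(1 + α) := by ring
    rw [this, Real.rpow_neg hxu.le]; rfl
  calc _ ≤ ENNReal.ofReal (|f x| * x ^ (-α) + |∫ u in Ioo 0 x, (f x - f u) / (x - u) ^ (1 + α)|) := by
        apply ENNReal.ofReal_le_ofReal
        refine (abs_add_le _ _).trans (add_le_add ?_ ?_)
        · rw [sub_zero, abs_div, abs_of_pos (by positivity : 0 < x ^ α), Real.rpow_neg hx.le]; rfl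
        · rw [abs_mul, abs_of_pos hα]
          exact mul_le_of_le_one_left (abs_nonneg _) hα'.le
    _ ≤ _ := by
        rw [ENNReal.ofReal_add (by positivity) (by positivity)]
        gcongr

lemma gls_bound {α T : ℝ} {f g : ℝ → ℝ} (hα0 : 0 < α) (hα : α < 1) (hg : ContinuousOn g (Icc 0 T))
    (h : zeroNorm α 0 T g < ⊤) {t : ℝ} (ht : t ≤ T) :
    ENNReal.ofReal |glsIntegral α 0 t f g| ≤
      ENNReal.ofReal (2 / Real.Gamma α * (zeroNorm α 0 T g).toReal) *
        ∫⁻ x in Ioo 0 t, ENNReal.ofReal |fracDerivP α 0 f x| := by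
  have hG := Real.Gamma_pos_of_pos hα0
  unfold glsIntegral
  rw [← Real.enorm_eq_ofReal_abs, ← lintegral_const_mul' _ _ ENNReal.ofReal_ne_top]
  refine (enorm_integral_le_lintegral_enorm _).trans ?_
  apply setLIntegral_mono' measurableSet_Ioo
  intro x hx
  rw [Real.enorm_eq_ofReal_abs, ← ENNReal.ofReal_mul (by positivity), abs_mul, mul_comm]
  apply ENNReal.ofReal_le_ofReal
  gcongr
  exact fracDerivM_bound hα0 hα hg h hx.1.le hx.2 ht

lemma gls_diff {α T : ℝ} {f g : ℝ → ℝ} (hα0 : 0 < α) (hα : α < 1) (hg : ContinuousOn g (Icc 0 T))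
    (h : zeroNorm α 0 T g < ⊤) (hgm : Measurable g) (hi : IntegrableOn (fracDerivP α 0 f) (Ioo 0 T))
    {s t : ℝ} (hs : 0 ≤ s) (hst : s < t) (ht : t ≤ T) :
    ENNReal.ofReal |glsIntegral α 0 t f g - glsIntegral α 0 s f g| ≤
      ENNReal.ofReal (3 / Real.Gamma α * (zeroNorm α 0 T g).toReal) *
        ((∫⁻ x in Ioo s t, ENNReal.ofReal |fracDerivP α 0 f x|) + ENNReal.ofReal ((t - s) ^ (1 - α)) *
          ∫⁻ x in Ioo 0 s, ENNReal.ofReal |fracDerivP α 0 f x| * ENNReal.ofReal ((s - x) ^ (-(1 - α)))) := by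
  have hG := Real.Gamma_pos_of_pos hα0
  have hΛ0 : 0 ≤ (zeroNorm α 0 T g).toReal := ENNReal.toReal_nonneg
  have hintg : ∀ b, b ≤ T → IntegrableOn (fun x => fracDerivP α 0 f x * fracDerivM α b g x) (Ioo 0 b) := by
    intro b hb
    have h1 : IntegrableOn (fracDerivP α 0 f) (Ioo 0 b) := hi.mono_set (Ioo_subset_Ioo le_rfl hb)
    apply Integrable.mul_bdd (c := 2 / Real.Gamma α * (zeroNorm α 0 T g).toReal) h1
      (fracDerivM_meas hgm).aestronglyMeasurable
    filter_upwards [self_mem_ae_restrict measurableSet_Ioo] with x hx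
    exact fracDerivM_bound hα0 hα hg h hx.1.le hx.2 hb
  have it := hintg t ht
  have is := hintg s (by linarith)
  have it1 : IntegrableOn (fun x => fracDerivP α 0 f x * fracDerivM α t g x) (Ioo 0 s) :=
    it.mono_set (Ioo_subset_Ioo le_rfl hst.le)
  have it2 : IntegrableOn (fun x => fracDerivP α 0 f x * fracDerivM α t g x) (Ioo s t) :=
    it.mono_set (Ioo_subset_Ioo hs le_rfl)
  have e : glsIntegral α 0 t f g - glsIntegral α 0 s f g =
      (∫ x in Ioo s t, fracDerivP α 0 f x * fracDerivM α t g x) +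
      ∫ x in Ioo 0 s, fracDerivP α 0 f x * (fracDerivM α t g x - fracDerivM α s g x) := by
    simp only [mul_sub]
    rw [integral_sub it1 is]
    unfold glsIntegral
    have : (∫ x in Ioo 0 t, fracDerivP α 0 f x * fracDerivM α t g x) = (∫ x in Ioo 0 s, fracDerivP α 0 f x * fracDerivM α t g x)
       + (∫ x in Ioo s t, fracDerivP α 0 f x * fracDerivM α t g x) := by
      simp only [← integral_Ioc_eq_integral_Ioo]
      rw [← intervalIntegral.integral_of_le hs, ← intervalIntegral.integral_of_le hst.le,
        ← intervalIntegral.integral_of_le (hs.trans hst.le)]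
      symm
      apply intervalIntegral.integral_add_adjacent_intervals
      · exact (intervalIntegrable_iff_integrableOn_Ioo_of_le hs).2 it1
      · exact (intervalIntegrable_iff_integrableOn_Ioo_of_le hst.le).2 it2
    rw [this]; ring
  rw [e, mul_add]
  refine (ENNReal.ofReal_le_ofReal (abs_add_le _ _)).trans ?_
  rw [ENNReal.ofReal_add (abs_nonneg _) (abs_nonneg _)]
  apply add_le_add
  · rw [← Real.enorm_eq_ofReal_abs, ← lintegral_const_mul' _ _ ENNReal.ofReal_ne_top]
    refine (enorm_integral_le_lintegral_enorm _).trans ?_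
    apply setLIntegral_mono' measurableSet_Ioo
    intro x hx
    rw [Real.enorm_eq_ofReal_abs, ← ENNReal.ofReal_mul (by positivity), abs_mul, mul_comm]
    apply ENNReal.ofReal_le_ofReal
    gcongr
    refine (fracDerivM_bound hα0 hα hg h (hs.trans hx.1.le) hx.2 ht).trans ?_
    gcongr; norm_num
  · rw [← Real.enorm_eq_ofReal_abs, ← lintegral_const_mul' _ _ ENNReal.ofReal_ne_top,
      ← lintegral_const_mul' _ _ ENNReal.ofReal_ne_top]
    refine (enorm_integral_le_lintegral_enorm _).trans ?_
    apply setLIntegral_mono' measurableSet_Ioo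
    intro x hx
    have hts : 0 < t - s := sub_pos.2 hst
    have hsx : 0 < s - x := sub_pos.2 hx.2
    rw [Real.enorm_eq_ofReal_abs, ← ENNReal.ofReal_mul (by positivity), ← ENNReal.ofReal_mul (by positivity),
      ← ENNReal.ofReal_mul (by positivity), abs_mul]
    apply ENNReal.ofReal_le_ofReal
    have := mul_le_mul_of_nonneg_left (fracDerivM_diff hα0 hα hg h hx.1.le hx.2 hst ht) (abs_nonneg (fracDerivP α 0 f x))
    refine this.trans (le_of_eq (by ring))


lemma le_supNorm {α T : ℝ} {f : ℝ → ℝ} {t : ℝ} (ht : t ∈ Icc 0 T) :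
    ENNReal.ofReal |f t| ≤ supNorm α T f ∧ pathNorm α f t ≤ supNorm α T f := by
  unfold supNorm
  constructor
  · exact le_trans (le_iSup₂ (f := fun (s : ℝ) (_ : s ∈ Icc (0:ℝ) T) => ENNReal.ofReal |f s|) t ht) le_self_add
  · exact le_trans (le_iSup₂ (f := fun (s : ℝ) (_ : s ∈ Icc (0:ℝ) T) => pathNorm α f s) t ht) le_add_self

lemma pathNorm_f {α β T M : ℝ} (hβ : α < β) (hM : 0 < M) {f X : ℝ → ℝ} (hX : Measurable X)
    (hfX : ∀ s ∈ Icc 0 T, ∀ t ∈ Icc 0 T, |f t - f s| ≤ M * (|t - s| ^ β + |X t - X s|))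
    {x : ℝ} (hx : x ∈ Icc 0 T) :
    pathNorm α f x ≤ ENNReal.ofReal (M * (1 + T ^ (β - α) / (β - α))) * (1 + pathNorm α X x) := by
  have hβα : 0 < β - α := sub_pos.2 hβ
  have hT0 : 0 ≤ T := hx.1.trans hx.2
  have h1 : pathNorm α f x ≤ ENNReal.ofReal M * (ENNReal.ofReal (T ^ (β - α) / (β - α)) + pathNorm α X x) := by
    unfold pathNorm
    calc _ ≤ ∫⁻ u in Ioo 0 x, ENNReal.ofReal M * (ENNReal.ofReal ((x - u) ^ (-(1 + α - β))) +
          ENNReal.ofReal (|X x - X u| * (x - u) ^ (-1 - α))) := by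
          apply setLIntegral_mono' measurableSet_Ioo
          intro u hu
          have hxu : 0 < x - u := sub_pos.2 hu.2
          rw [← ENNReal.ofReal_add (by positivity) (by positivity), ← ENNReal.ofReal_mul hM.le]
          apply ENNReal.ofReal_le_ofReal
          have := hfX u ⟨hu.1.le, hu.2.le.trans hx.2⟩ x hx
          rw [abs_of_pos hxu] at this
          calc _ ≤ M * ((x - u) ^ β + |X x - X u|) * (x - u) ^ (-1 - α) := by gcongr
            _ = _ := by
              have e : -(1 + α - β) = β + (-1 - α) := by ring
              rw [e, Real.rpow_add hxu]; ring
      _ = ENNReal.ofReal M * (ENNReal.ofReal ((x - 0) ^ (1 - (1 + α - β)) / (1 - (1 + α - β))) + pathNorm α X x) := by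
          rw [lintegral_const_mul' _ _ ENNReal.ofReal_ne_top, lintegral_add_left (by fun_prop),
            lint_right (by linarith) hx.1]
          rfl
      _ ≤ _ := by
          have e : 1 - (1 + α - β) = β - α := by ring
          rw [e, sub_zero]
          have := Real.rpow_le_rpow hx.1 hx.2 hβα.le
          gcongr
          rfl
  refine h1.trans ?_
  have hc : 0 ≤ T ^ (β - α) / (β - α) := by positivity
  rw [ENNReal.ofReal_mul hM.le, mul_assoc]
  gcongr
  rw [ENNReal.ofReal_add (by norm_num) hc, ENNReal.ofReal_one]
  set c := ENNReal.ofReal (T ^ (β - α) / (β - α))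
  set P := pathNorm α X x
  calc c + P ≤ (c + P) + (1 + c * P) := le_self_add
    _ = (1 + c) * (1 + P) := by ring

lemma Phi_bound {α β T M : ℝ} (hα : 0 < α) (hα' : α < 1) (hβ : α < β) (hM : 0 < M) (hT : 0 < T)
    {f X : ℝ → ℝ} (hX : Measurable X)
    (hf : ∀ t ∈ Icc 0 T, |f t| ≤ M * (1 + |X t|))
    (hfX : ∀ s ∈ Icc 0 T, ∀ t ∈ Icc 0 T, |f t - f s| ≤ M * (|t - s| ^ β + |X t - X s|))
    {x : ℝ} (hx : x ∈ Ioo 0 T) :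
    ENNReal.ofReal |fracDerivP α 0 f x| + ENNReal.ofReal (M * (1 + |X x|)) ≤
      ENNReal.ofReal (1 / Real.Gamma (1 - α) * (M * (1 + T ^ (β - α) / (β - α))) + M * T ^ α) *
      (ENNReal.ofReal (1 + |X x|) * ENNReal.ofReal (x ^ (-α)) + (1 + pathNorm α X x)) := by
  have hG := Real.Gamma_pos_of_pos (s := 1 - α) (by linarith)
  have hβα : 0 < β - α := sub_pos.2 hβ
  have hx0 := hx.1
  have hxT : x ∈ Icc 0 T := ⟨hx.1.le, hx.2.le⟩
  rw [ENNReal.ofReal_add (by positivity) (by positivity), add_mul]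
  apply add_le_add
  · refine (fracDerivP_bound hα hα' f hx0).trans ?_
    rw [ENNReal.ofReal_mul (p := 1 / Real.Gamma (1 - α)) (by positivity), mul_assoc]
    gcongr
    rw [mul_add]
    apply add_le_add
    · rw [← ENNReal.ofReal_mul (by positivity), ← ENNReal.ofReal_mul (by positivity)]
      apply ENNReal.ofReal_le_ofReal
      have h2 : 0 ≤ T ^ (β - α) / (β - α) := by positivity
      calc _ ≤ M * (1 + |X x|) * x ^ (-α) := by gcongr; exact hf x hxT
        _ = M * 1 * ((1 + |X x|) * x ^ (-α)) := by ring
        _ ≤ _ := by gcongr; linarith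
    · exact pathNorm_f hβ hM hX hfX hxT
  · have : ENNReal.ofReal (M * (1 + |X x|)) ≤ ENNReal.ofReal (M * T ^ α) * (ENNReal.ofReal (1 + |X x|) * ENNReal.ofReal (x ^ (-α))) := by
      rw [← ENNReal.ofReal_mul (by positivity), ← ENNReal.ofReal_mul (by positivity)]
      apply ENNReal.ofReal_le_ofReal
      have h1 : 1 ≤ T ^ α * x ^ (-α) := by
        rw [Real.rpow_neg hx0.le, ← div_eq_mul_inv, one_le_div (by positivity)]
        exact Real.rpow_le_rpow hx0.le hx.2.le hα.le
      calc _ = M * (1 + |X x|) * 1 := by ring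
        _ ≤ M * (1 + |X x|) * (T ^ α * x ^ (-α)) := by gcongr
        _ = _ := by ring
    refine this.trans ?_
    gcongr
    exact le_self_add

set_option maxHeartbeats 2000000 in
lemma core {α β T M : ℝ} (hα : 0 < α) (hα' : α < 1 / 2) (hβ : α < β) (hM : 0 < M) (hT : 0 < T) :
    ∃ C : ℝ, 0 < C ∧ ∀ (av f g F X : ℝ → ℝ), Measurable av → Measurable f → Measurable g →
      Measurable F → Measurable X → ContinuousOn g (Icc 0 T) → zeroNorm α 0 T g < ⊤ →
      supNorm α T F < ⊤ → supNorm α T X < ⊤ →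
      (∀ t ∈ Icc 0 T, |av t| ≤ M * (1 + |X t|)) → (∀ t ∈ Icc 0 T, |f t| ≤ M * (1 + |X t|)) →
      (∀ s ∈ Icc 0 T, ∀ t ∈ Icc 0 T, |f t - f s| ≤ M * (|t - s| ^ β + |X t - X s|)) →
      (∀ t ∈ Icc 0 T, X t = X 0 + (∫ s in Ioo 0 t, av s) + F t + glsIntegral α 0 t f g) →
      (supNorm α T X).toReal ≤
        C * (1 + |X 0|) *
          Real.exp (C * (zeroNorm α 0 T g).toReal ^ (1 / (1 - α))) *
          (1 + (supNorm α T F).toReal) := by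
  have hα1 : α < 1 := by linarith
  have h1α : 0 < 1 - α := by linarith
  have hG := Real.Gamma_pos_of_pos (s := 1 - α) (by linarith)
  have hGα := Real.Gamma_pos_of_pos hα
  have hβα : 0 < β - α := sub_pos.2 hβ
  set C1 := 1 / Real.Gamma (1 - α) * (M * (1 + T ^ (β - α) / (β - α))) + M * T ^ α with hC1
  have hC1p : 0 < C1 := by positivity
  obtain ⟨Ck, hCk, hkern⟩ := kern hα hα'
  obtain ⟨C2, hC2, hgron⟩ := gronwall_frac hα hα' hT
  set E := (1 + Ck) * (C1 + 1) * (1 + 3 / Real.Gamma α) with hE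
  have hEp : 0 < E := by positivity
  set r := 1 / (1 - α) with hr
  have hr0 : 0 < r := by positivity
  set W := C2 * (2 * E) ^ r with hW
  have hW0 : 0 < W := by positivity
  refine ⟨2 * C2 * Real.exp W + W, by positivity, ?_⟩
  intro av f g F X hav hf hg hF hX hgc hz hFs hXs hab hfb hfX heq
  set Λ := (zeroNorm α 0 T g).toReal with hΛ
  have hΛ0 : 0 ≤ Λ := ENNReal.toReal_nonneg
  set N := (supNorm α T F).toReal with hN
  have hN0 : 0 ≤ N := ENNReal.toReal_nonneg
  set S := (supNorm α T X).toReal with hS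
  have hS0 : 0 ≤ S := ENNReal.toReal_nonneg
  have hNe : supNorm α T F = ENNReal.ofReal N := (ENNReal.ofReal_toReal hFs.ne).symm
  have hSe : supNorm α T X = ENNReal.ofReal S := (ENNReal.ofReal_toReal hXs.ne).symm
  set φ := fracDerivP α 0 f with hφ
  have hφm : Measurable φ := fracDerivP_meas hf
  set Φ : ℝ → ℝ≥0∞ := fun x => ENNReal.ofReal |φ x| + ENNReal.ofReal (M * (1 + |X x|)) with hΦ
  have hΦm : Measurable Φ := by
    refine Measurable.add (f := fun x => ENNReal.ofReal |φ x|) (g := fun x => ENNReal.ofReal (M * (1 + |X x|))) ?_ ?_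
    · exact ENNReal.measurable_ofReal.comp (measurable_norm.comp hφm)
    · exact ENNReal.measurable_ofReal.comp (((measurable_norm.comp hX).const_add 1).const_mul M)
  have hφΦ : ∀ x, ENNReal.ofReal |φ x| ≤ Φ x := fun x => le_self_add
  set Y : ℝ → ℝ≥0∞ := fun x => ENNReal.ofReal (1 + |X x|) with hY
  set Z : ℝ → ℝ≥0∞ := fun x => 1 + pathNorm α X x with hZ
  have hΦb : ∀ x ∈ Ioo 0 T, Φ x ≤ ENNReal.ofReal C1 * (Y x * ENNReal.ofReal (x ^ (-α)) + Z x) :=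
    fun x hx => Phi_bound hα hα1 hβ hM hT hX hfb hfX hx
  have hYB : ∀ t ∈ Icc 0 T, Y t ≤ ENNReal.ofReal (1 + S) := by
    intro t ht
    have := (le_supNorm (α := α) (f := X) ht).1
    rw [hSe, ENNReal.ofReal_le_ofReal_iff hS0] at this
    exact ENNReal.ofReal_le_ofReal (by linarith)
  have hZB : ∀ t ∈ Icc 0 T, Z t ≤ ENNReal.ofReal (1 + S) := by
    intro t ht
    have := (le_supNorm (α := α) (f := X) ht).2
    rw [hSe] at this
    rw [ENNReal.ofReal_add (by norm_num) hS0, ENNReal.ofReal_one]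
    exact add_le_add le_rfl this
  have hφi : IntegrableOn φ (Ioo 0 T) := by
    refine ⟨hφm.aestronglyMeasurable, ?_⟩
    unfold HasFiniteIntegral
    have : ∫⁻ x in Ioo 0 T, ‖φ x‖ₑ ≤ ∫⁻ x in Ioo 0 T, ENNReal.ofReal C1 * (ENNReal.ofReal (1 + S) * ENNReal.ofReal ((x - 0) ^ (-α)) + ENNReal.ofReal (1 + S)) := by
      apply setLIntegral_mono' measurableSet_Ioo
      intro x hx
      have hxT : x ∈ Icc 0 T := ⟨hx.1.le, hx.2.le⟩
      rw [Real.enorm_eq_ofReal_abs, sub_zero]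
      refine (hφΦ x).trans ((hΦb x hx).trans ?_)
      gcongr
      · exact hYB x hxT
      · exact hZB x hxT
    refine this.trans_lt ?_
    rw [lintegral_const_mul _ (by fun_prop), lintegral_add_left (by fun_prop),
      lintegral_const_mul _ (by fun_prop), lint_left hα1 hT.le, lintegral_const]
    simp only [MeasurableSet.univ, Measure.restrict_apply, univ_inter, Real.volume_Ioo]
    apply ENNReal.mul_lt_top ENNReal.ofReal_lt_top
    apply ENNReal.add_lt_top.2
    exact ⟨ENNReal.mul_lt_top ENNReal.ofReal_lt_top ENNReal.ofReal_lt_top,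
      ENNReal.mul_lt_top ENNReal.ofReal_lt_top ENNReal.ofReal_lt_top⟩
  have hai : IntegrableOn av (Ioo 0 T) := by
    apply Measure.integrableOn_of_bounded (M := M * (1 + S)) (by simp) hav.aestronglyMeasurable
    filter_upwards [self_mem_ae_restrict measurableSet_Ioo] with x hx
    have hxT : x ∈ Icc 0 T := ⟨hx.1.le, hx.2.le⟩
    refine (hab x hxT).trans ?_
    have := hYB x hxT
    rw [hY, ENNReal.ofReal_le_ofReal_iff (by linarith)] at this
    gcongr
  have hA : ∀ s t, 0 ≤ s → s ≤ t → t ≤ T →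
      ENNReal.ofReal |∫ u in Ioo s t, av u| ≤ ∫⁻ x in Ioo s t, Φ x := by
    intro s t hs hst ht
    rw [← Real.enorm_eq_ofReal_abs]
    refine (enorm_integral_le_lintegral_enorm _).trans ?_
    apply setLIntegral_mono' measurableSet_Ioo
    intro x hx
    rw [Real.enorm_eq_ofReal_abs]
    refine le_trans (ENNReal.ofReal_le_ofReal (hab x ⟨hs.trans hx.1.le, hx.2.le.trans ht⟩)) ?_
    exact le_add_self
  have hAd : ∀ s t, 0 ≤ s → s ≤ t → t ≤ T →
      (∫ u in Ioo 0 t, av u) - (∫ u in Ioo 0 s, av u) = ∫ u in Ioo s t, av u := by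
    intro s t hs hst ht
    simp only [← integral_Ioc_eq_integral_Ioo]
    rw [← intervalIntegral.integral_of_le hs, ← intervalIntegral.integral_of_le hst,
        ← intervalIntegral.integral_of_le (hs.trans hst)]
    apply intervalIntegral.integral_interval_sub_left
    · exact (intervalIntegrable_iff_integrableOn_Ioo_of_le (hs.trans hst)).2 (hai.mono_set (Ioo_subset_Ioo le_rfl ht))
    · exact (intervalIntegrable_iff_integrableOn_Ioo_of_le hs).2 (hai.mono_set (Ioo_subset_Ioo le_rfl (hst.trans ht)))
  set H := 1 + 3 / Real.Gamma α * Λ with hH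
  have hH1 : 1 ≤ H := by
    have : 0 ≤ 3 / Real.Gamma α * Λ := by positivity
    linarith
  have hH0 : 0 < H := by linarith
  set D := (1 + Ck) * (C1 + 1) * H with hD
  have hD1 : 1 ≤ D := by
    have : 1 ≤ (1 + Ck) * (C1 + 1) := by nlinarith
    nlinarith
  set K := (1 + |X 0|) * (1 + N) with hK
  have hK0 : 0 ≤ K := by positivity
  -- bound for Y
  have hYI : ∀ t ∈ Icc 0 T, Y t ≤ ENNReal.ofReal K + ENNReal.ofReal D *
        ∫⁻ x in Ioo 0 t, (Y x * ENNReal.ofReal (x ^ (-α)) + Z x) := by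
    intro t ht
    have hFt := (le_supNorm (α := α) (f := F) ht).1
    rw [hNe, ENNReal.ofReal_le_ofReal_iff hN0] at hFt
    have e1 : 1 + |X t| ≤ K + (|∫ u in Ioo 0 t, av u| + |glsIntegral α 0 t f g|) := by
      have h1 : |X t| ≤ |X 0| + |∫ s in Ioo 0 t, av s| + |F t| + |glsIntegral α 0 t f g| := by
        rw [heq t ht]
        exact (abs_add_le _ _).trans (add_le_add ((abs_add_le _ _).trans (add_le_add (abs_add_le _ _) le_rfl)) le_rfl)
      have h2 : 1 + |X 0| + N ≤ K := by
        have := mul_nonneg (abs_nonneg (X 0)) hN0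
        rw [hK]; linarith
      linarith
    calc Y t ≤ ENNReal.ofReal (K + (|∫ u in Ioo 0 t, av u| + |glsIntegral α 0 t f g|)) := ENNReal.ofReal_le_ofReal e1
      _ = ENNReal.ofReal K + (ENNReal.ofReal |∫ u in Ioo 0 t, av u| + ENNReal.ofReal |glsIntegral α 0 t f g|) := by
        rw [ENNReal.ofReal_add hK0 (by positivity), ENNReal.ofReal_add (by positivity) (by positivity)]
      _ ≤ ENNReal.ofReal K + ENNReal.ofReal H * ∫⁻ x in Ioo 0 t, Φ x := by
        gcongr
        rw [hH, ENNReal.ofReal_add (by norm_num) (by positivity), add_mul, ENNReal.ofReal_one, one_mul]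
        apply add_le_add (hA 0 t le_rfl ht.1 ht.2)
        refine (gls_bound hα hα1 hgc hz ht.2).trans ?_
        apply mul_le_mul'
        · apply ENNReal.ofReal_le_ofReal
          gcongr; norm_num
        · exact lintegral_mono hφΦ
      _ ≤ ENNReal.ofReal K + ENNReal.ofReal H * (ENNReal.ofReal C1 * ∫⁻ x in Ioo 0 t, (Y x * ENNReal.ofReal (x ^ (-α)) + Z x)) := by
        gcongr
        rw [← lintegral_const_mul' _ _ ENNReal.ofReal_ne_top]
        apply setLIntegral_mono' measurableSet_Ioo
        intro x hx
        exact hΦb x ⟨hx.1, hx.2.trans_le ht.2⟩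
      _ ≤ _ := by
        rw [← mul_assoc, ← ENNReal.ofReal_mul hH0.le]
        gcongr
        rw [hD, mul_comm H]
        gcongr
        nlinarith
  have hZI : ∀ t ∈ Icc 0 T, Z t ≤ ENNReal.ofReal K + ENNReal.ofReal D *
        ∫⁻ x in Ioo 0 t, (Y x * ENNReal.ofReal (x ^ (-α)) + Z x) * ENNReal.ofReal ((t - x) ^ (-α)) := by
    intro t ht
    have hFt := (le_supNorm (α := α) (f := F) ht).2
    rw [hNe] at hFt
    have e1 : pathNorm α X t ≤ pathNorm α F t + ENNReal.ofReal H * (∫⁻ s in Ioo 0 t, ENNReal.ofReal ((t - s) ^ (-1 - α)) * ((∫⁻ x in Ioo s t, Φ x) +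
        ENNReal.ofReal ((t - s) ^ (1 - α)) * ∫⁻ x in Ioo 0 s, Φ x * ENNReal.ofReal ((s - x) ^ (-(1 - α))))) := by
      unfold pathNorm
      rw [← lintegral_const_mul' _ _ ENNReal.ofReal_ne_top, ← lintegral_add_left (by fun_prop)]
      apply setLIntegral_mono' measurableSet_Ioo
      intro s hs
      have hsT : s ∈ Icc 0 T := ⟨hs.1.le, hs.2.le.trans ht.2⟩
      have hts : 0 < t - s := sub_pos.2 hs.2
      set w := (t - s) ^ (-1 - α) with hw
      have hw0 : 0 ≤ w := by positivity
      have h1 : |X t - X s| ≤ |F t - F s| + (|∫ u in Ioo s t, av u| + |glsIntegral α 0 t f g - glsIntegral α 0 s f g|) := by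
        rw [heq t ht, heq s hsT, ← hAd s t hs.1.le hs.2.le ht.2]
        set a1 := ∫ u in Ioo 0 t, av u
        set a2 := ∫ u in Ioo 0 s, av u
        have : X 0 + a1 + F t + glsIntegral α 0 t f g - (X 0 + a2 + F s + glsIntegral α 0 s f g) =
          (F t - F s) + ((a1 - a2) + (glsIntegral α 0 t f g - glsIntegral α 0 s f g)) := by ring
        rw [this]
        exact (abs_add_le _ _).trans (add_le_add le_rfl (abs_add_le _ _))
      calc _ ≤ ENNReal.ofReal ((|F t - F s| + (|∫ u in Ioo s t, av u| + |glsIntegral α 0 t f g - glsIntegral α 0 s f g|)) * w) := by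
            gcongr
        _ = ENNReal.ofReal (|F t - F s| * w) + (ENNReal.ofReal |∫ u in Ioo s t, av u| + ENNReal.ofReal |glsIntegral α 0 t f g - glsIntegral α 0 s f g|) * ENNReal.ofReal w := by
            rw [add_mul, ENNReal.ofReal_add (by positivity) (by positivity), ENNReal.ofReal_mul (p := |∫ u in Ioo s t, av u| + |glsIntegral α 0 t f g - glsIntegral α 0 s f g|) (by positivity), ENNReal.ofReal_add (by positivity) (by positivity)]
        _ ≤ _ := by
            refine add_le_add le_rfl ?_
            rw [mul_comm (ENNReal.ofReal w), ← mul_assoc]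
            refine mul_le_mul' ?_ le_rfl
            rw [hH, ENNReal.ofReal_add (by norm_num) (by positivity), add_mul, ENNReal.ofReal_one, one_mul]
            apply add_le_add
            · exact (hA s t hs.1.le hs.2.le ht.2).trans le_self_add
            · refine (gls_diff hα hα1 hgc hz hg hφi hs.1.le hs.2 ht.2).trans ?_
              gcongr
              · exact hφΦ _
              · exact hφΦ _
    have e2 := hkern Φ hΦm t
    calc Z t ≤ ENNReal.ofReal K + ENNReal.ofReal H * (ENNReal.ofReal Ck * ∫⁻ x in Ioo 0 t, Φ x * ENNReal.ofReal ((t - x) ^ (-α))) := by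
          have : Z t ≤ (1 + ENNReal.ofReal N) + ENNReal.ofReal H * (ENNReal.ofReal Ck * ∫⁻ x in Ioo 0 t, Φ x * ENNReal.ofReal ((t - x) ^ (-α))) := by
            rw [add_assoc]
            exact add_le_add le_rfl (e1.trans (add_le_add hFt (mul_le_mul' le_rfl e2)))
          refine this.trans (add_le_add ?_ le_rfl)
          rw [← ENNReal.ofReal_one, ← ENNReal.ofReal_add (by norm_num) hN0]
          apply ENNReal.ofReal_le_ofReal
          rw [hK]
          nlinarith [abs_nonneg (X 0)]
      _ ≤ ENNReal.ofReal K + ENNReal.ofReal H * (ENNReal.ofReal Ck * (ENNReal.ofReal C1 * ∫⁻ x in Ioo 0 t, (Y x * ENNReal.ofReal (x ^ (-α)) + Z x) * ENNReal.ofReal ((t - x) ^ (-α)))) := by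
        gcongr
        rw [← lintegral_const_mul' _ _ ENNReal.ofReal_ne_top]
        apply setLIntegral_mono' measurableSet_Ioo
        intro x hx
        rw [← mul_assoc]
        gcongr
        exact hΦb x ⟨hx.1, hx.2.trans_le ht.2⟩
      _ ≤ _ := by
        rw [← mul_assoc, ← mul_assoc, ← ENNReal.ofReal_mul hH0.le, ← ENNReal.ofReal_mul (by positivity)]
        gcongr
        have : H * Ck * C1 = Ck * C1 * H := by ring
        rw [hD, this]
        gcongr <;> linarith
  have hfin := hgron Y Z _ K D hK0 hD1 ENNReal.ofReal_ne_top hYB hZB hYI hZI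
  set V := C2 * K * Real.exp (C2 * D ^ r) with hV
  have hV0 : 0 ≤ V := by positivity
  have hsup : supNorm α T X ≤ ENNReal.ofReal V + ENNReal.ofReal V := by
    apply add_le_add
    · apply iSup₂_le
      intro t ht
      refine le_trans ?_ (hfin t ht).1
      apply ENNReal.ofReal_le_ofReal; linarith
    · apply iSup₂_le
      intro t ht
      exact le_trans le_add_self (hfin t ht).2
  rw [← ENNReal.ofReal_add hV0 hV0] at hsup
  have hSV : S ≤ V + V := ENNReal.toReal_le_of_le_ofReal (by positivity) hsup
  have hDE : D ≤ E * (1 + Λ) := by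
    rw [hD, hE, mul_assoc ((1 + Ck) * (C1 + 1))]
    gcongr
    have : 0 ≤ 3 / Real.Gamma α := by positivity
    rw [hH]; nlinarith
  have hpow : (1 + Λ) ^ r ≤ 2 ^ r * (1 + Λ ^ r) := by
    have hΛr : 0 ≤ Λ ^ r := by positivity
    rcases le_total Λ 1 with h | h
    · calc (1 + Λ) ^ r ≤ 2 ^ r := Real.rpow_le_rpow (by positivity) (by linarith) hr0.le
        _ = 2 ^ r * 1 := by ring
        _ ≤ _ := by gcongr; linarith
    · calc (1 + Λ) ^ r ≤ (2 * Λ) ^ r := Real.rpow_le_rpow (by positivity) (by linarith) hr0.le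
        _ = 2 ^ r * Λ ^ r := Real.mul_rpow (by norm_num) hΛ0
        _ ≤ _ := by gcongr; linarith
  have hDr : C2 * D ^ r ≤ W + W * Λ ^ r := by
    calc C2 * D ^ r ≤ C2 * (E * (1 + Λ)) ^ r := by gcongr
      _ = C2 * (E ^ r * (1 + Λ) ^ r) := by rw [Real.mul_rpow hEp.le (by positivity)]
      _ ≤ C2 * (E ^ r * (2 ^ r * (1 + Λ ^ r))) := by gcongr
      _ = _ := by rw [hW, Real.mul_rpow (by norm_num) hEp.le]; ring
  have hΛr : 0 ≤ Λ ^ r := by positivity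
  calc S ≤ 2 * C2 * K * Real.exp (C2 * D ^ r) := by rw [hV] at hSV; linarith
    _ ≤ 2 * C2 * K * Real.exp (W + W * Λ ^ r) := by gcongr
    _ = 2 * C2 * Real.exp W * (1 + |X 0|) * Real.exp (W * Λ ^ r) * (1 + N) := by
      rw [Real.exp_add, hK]; ring
    _ ≤ _ := by
      have q1 : 0 ≤ 2 * C2 * Real.exp W := by positivity
      gcongr <;> linarith


lemma comp_meas {β T M : ℝ} (hβ : 0 < β) (hM : 0 < M) (hT : 0 < T) {k : ℝ → ℝ → ℝ}
    (h1 : ∀ t ∈ Icc 0 T, ∀ x y : ℝ, |k t x - k t y| ≤ M * |x - y|)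
    (h2 : ∀ s ∈ Icc 0 T, ∀ t ∈ Icc 0 T, ∀ x : ℝ, |k s x - k t x| ≤ M * |s - t| ^ β)
    {X : ℝ → ℝ} (hX : Measurable X) :
    Measurable fun s => k (max 0 (min T s)) (X s) := by
  have hτ : ∀ s : ℝ, max 0 (min T s) ∈ Icc 0 T := fun s =>
    ⟨le_max_left _ _, max_le hT.le (min_le_left _ _)⟩
  have hc : Continuous fun p : ℝ × ℝ => k (max 0 (min T p.1)) p.2 := by
    rw [continuous_iff_continuousAt]
    intro p0
    unfold ContinuousAt
    rw [tendsto_iff_dist_tendsto_zero]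
    have hcont : Continuous fun p : ℝ × ℝ =>
        M * |p.2 - p0.2| + M * |max 0 (min T p.1) - max 0 (min T p0.1)| ^ β := by
      refine Continuous.add (by fun_prop) (continuous_const.mul ?_)
      exact Continuous.rpow_const (by fun_prop) (fun _ => Or.inr hβ.le)
    have h0 := hcont.tendsto p0
    simp only [sub_self, abs_zero, mul_zero, Real.zero_rpow hβ.ne', add_zero] at h0
    refine squeeze_zero (fun _ => dist_nonneg) (fun p => ?_) h0
    rw [Real.dist_eq]
    refine (abs_sub_le _ (k (max 0 (min T p.1)) p0.2) _).trans ?_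
    exact add_le_add (h1 _ (hτ _) _ _) (h2 _ (hτ _) _ (hτ _) _)
  exact hc.measurable.comp (measurable_id.prodMk hX)

lemma zeroNorm_congr {α T : ℝ} {g g1 : ℝ → ℝ} (h : ∀ t ∈ Icc 0 T, g t = g1 t) :
    zeroNorm α 0 T g = zeroNorm α 0 T g1 := by
  unfold zeroNorm
  refine iSup_congr fun u => iSup_congr fun v => iSup_congr fun hu => iSup_congr fun huv =>
    iSup_congr fun hv => ?_
  rw [h u ⟨hu, (huv.trans hv).le⟩, h v ⟨hu.trans huv.le, hv.le⟩]
  congr 2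
  apply setIntegral_congr_fun measurableSet_Ioo
  intro z hz
  simp only
  rw [h z ⟨hu.trans hz.1.le, (hz.2.trans hv).le⟩]

lemma gls_congr {α T t : ℝ} (ht : t ∈ Icc 0 T) {f f1 g g1 : ℝ → ℝ} (hf : ∀ t ∈ Icc 0 T, f t = f1 t)
    (hg : ∀ t ∈ Icc 0 T, g t = g1 t) :
    glsIntegral α 0 t f g = glsIntegral α 0 t f1 g1 := by
  unfold glsIntegral
  apply setIntegral_congr_fun measurableSet_Ioo
  intro x hx
  have hxT : x ∈ Icc 0 T := ⟨hx.1.le, hx.2.le.trans ht.2⟩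
  simp only [fracDerivP, fracDerivM]
  rw [hf x hxT, hg x hxT, hg t ht]
  congr 3
  · congr 1
    apply setIntegral_congr_fun measurableSet_Ioo
    intro u hu
    simp only
    rw [hf u ⟨hu.1.le, hu.2.le.trans hxT.2⟩]
  · congr 1
    apply setIntegral_congr_fun measurableSet_Ioo
    intro u hu
    simp only
    rw [hg u ⟨hxT.1.trans hu.1.le, hu.2.le.trans ht.2⟩]

theorem pathwise_estimate_mixed (α β T M : ℝ)
    (hα : α ∈ Set.Ioo (0 : ℝ) (1 / 2)) (hβ : β ∈ Set.Ioo α 1)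
    (hT : 0 < T) (hM : 0 < M) :
    ∃ C : ℝ, 0 < C ∧ ∀ (a c : ℝ → ℝ → ℝ) (g F X : ℝ → ℝ),
      (∀ t ∈ Set.Icc 0 T, ∀ x : ℝ, |a t x| + |c t x| ≤ M * (1 + |x|)) →
      (∀ t ∈ Set.Icc 0 T, ∀ x y : ℝ,
        |a t x - a t y| + |c t x - c t y| ≤ M * |x - y|) →
      (∀ s ∈ Set.Icc 0 T, ∀ t ∈ Set.Icc 0 T, ∀ x : ℝ,
        |a s x - a t x| + |c s x - c t x| ≤ M * |s - t| ^ β) →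
      ContinuousOn g (Set.Icc 0 T) →
      zeroNorm α 0 T g < ⊤ →
      Measurable F → F 0 = 0 → supNorm α T F < ⊤ →
      Measurable X → supNorm α T X < ⊤ →
      (∀ t ∈ Set.Icc 0 T,
        X t = X 0 + (∫ s in Ioo (0 : ℝ) t, a s (X s)) + F t
          + glsIntegral α 0 t (fun s => c s (X s)) g) →
      (supNorm α T X).toReal ≤
        C * (1 + |X 0|) *
          Real.exp (C * (zeroNorm α 0 T g).toReal ^ (1 / (1 - α))) *
          (1 + (supNorm α T F).toReal) := by
  obtain ⟨C, hC, hcore⟩ := core hα.1 hα.2 hβ.1 hM hT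
  refine ⟨C, hC, ?_⟩
  intro a c g F X hgrow hlip hhol hgc hz hF _ hFs hX hXs heq
  have hβ0 : 0 < β := hα.1.trans hβ.1
  have hτ : ∀ s : ℝ, max 0 (min T s) ∈ Icc 0 T := fun s =>
    ⟨le_max_left _ _, max_le hT.le (min_le_left _ _)⟩
  have hτe : ∀ s ∈ Icc 0 T, max 0 (min T s) = s := fun s hs => by
    rw [min_eq_right hs.2, max_eq_right hs.1]
  have hg1 : Continuous fun s => g (max 0 (min T s)) :=
    hgc.comp_continuous (by fun_prop) hτ
  have hge : ∀ t ∈ Icc 0 T, g t = g (max 0 (min T t)) := fun t ht => by rw [hτe t ht]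
  have hce : ∀ t ∈ Icc 0 T, c t (X t) = c (max 0 (min T t)) (X t) := fun t ht => by rw [hτe t ht]
  have hzc := zeroNorm_congr (α := α) hge
  rw [hzc]
  refine hcore (fun s => a (max 0 (min T s)) (X s)) (fun s => c (max 0 (min T s)) (X s))
    (fun s => g (max 0 (min T s))) F X ?_ ?_ hg1.measurable hF hX hg1.continuousOn (hzc ▸ hz)
    hFs hXs ?_ ?_ ?_ ?_
  · refine comp_meas hβ0 hM hT (fun t ht x y => ?_) (fun s hs t ht x => ?_) hX
    · exact (le_add_of_nonneg_right (abs_nonneg _)).trans (hlip t ht x y)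
    · exact (le_add_of_nonneg_right (abs_nonneg _)).trans (hhol s hs t ht x)
  · refine comp_meas hβ0 hM hT (fun t ht x y => ?_) (fun s hs t ht x => ?_) hX
    · exact (le_add_of_nonneg_left (abs_nonneg _)).trans (hlip t ht x y)
    · exact (le_add_of_nonneg_left (abs_nonneg _)).trans (hhol s hs t ht x)
  · intro t ht
    exact (le_add_of_nonneg_right (abs_nonneg _)).trans (hgrow _ (hτ t) (X t))
  · intro t ht
    exact (le_add_of_nonneg_left (abs_nonneg _)).trans (hgrow _ (hτ t) (X t))
  · intro s hs t ht
    rw [hτe s hs, hτe t ht, mul_add]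
    refine (abs_sub_le _ (c s (X t)) _).trans ?_
    exact add_le_add ((le_add_of_nonneg_left (abs_nonneg _)).trans (hhol t ht s hs (X t)))
      ((le_add_of_nonneg_left (abs_nonneg _)).trans (hlip s hs (X t) (X s)))
  · intro t ht
    rw [← gls_congr (α := α) (f := fun s => c s (X s)) ht hce hge]
    have hi : ∫ s in Ioo (0 : ℝ) t, a (max 0 (min T s)) (X s) = ∫ s in Ioo (0 : ℝ) t, a s (X s) := by
      apply setIntegral_congr_fun measurableSet_Ioo
      intro s hs
      simp only
      rw [hτe s ⟨hs.1.le, hs.2.le.trans ht.2⟩]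
    rw [hi]
    exact heq t ht
end
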